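/- arXiv:2409.10467 — 11 statements merged into one kernel-verified Lean document; each statement's English description precedes it below -/
import Mathlib

section
/- Let r be a prime and q a prime power with q ≡ 1 (mod r). Let f ∈ F_q[x] be given by f(x) = a·(x − γ)^r + c with a ≠ 0 and γ, c ∈ F_q (so f is a unicritical polynomial of degree r with critical point γ, leading coefficient a, and f(γ) = c). Then f is dynamically irreducible over F_q if and only if the set {−f(γ)/a} ∪ {f^n(γ)/a : n an integer ≥ 2} contains no r-th powers in F_q. -/
open Polynomial

/-- The `n`-fold composition `f ∘ f ∘ ... ∘ f` (`n` times) of a polynomial,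
with `f^0 = X` (the identity). -/
noncomputable def polyIter {K : Type*} [Field K] (f : K[X]) : ℕ → K[X]
  | 0 => X
  | n + 1 => f.comp (polyIter f n)

theorem FiniteField.exists_pow_eq_norm_iff {K L : Type*} [Field K] [Finite K] [Field L]
    [Algebra K L] [FiniteDimensional K L] {r : ℕ} (hr : r ≠ 0) (hK : r ∣ Nat.card K - 1) (x : L) :
    (∃ v : K, v ^ r = Algebra.norm K x) ↔ ∃ y : L, y ^ r = x := by
  have : Finite L := Module.finite_of_finite K
  refine ⟨?_, fun ⟨y, hy⟩ ↦ ⟨Algebra.norm K y, by rw [← hy, map_pow]⟩⟩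
  rintro ⟨v, hv⟩
  obtain rfl | hx := eq_or_ne x 0
  · exact ⟨0, zero_pow hr⟩
  obtain ⟨y, rfl⟩ := FiniteField.norm_surjective K L v
  have hy : y ≠ 0 := by
    rintro rfl
    rw [Algebra.norm_zero, zero_pow hr] at hv
    exact hx (Algebra.norm_eq_zero_iff.mp hv.symm)
  obtain ⟨g, hg⟩ := IsCyclic.exists_monoid_generator (α := Lˣ)
  obtain ⟨k, hk : g ^ k = _⟩ := hg (Units.mk0 x hx)
  obtain ⟨m, hm : g ^ m = _⟩ := hg (Units.mk0 y hy)
  have hgen : ∀ z : Kˣ, z ∈ Subgroup.zpowers (Units.map (Algebra.norm K (S := L)) g) := by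
    intro z
    obtain ⟨u, rfl⟩ := FiniteField.unitsMap_norm_surjective K L z
    obtain ⟨j, hj : g ^ j = _⟩ := hg u
    exact ⟨j, by simp [← hj]⟩
  have hord := orderOf_eq_card_of_forall_mem_zpowers hgen
  rw [Nat.card_units] at hord
  have hpow : Units.map (Algebra.norm K (S := L)) g ^ (m * r) =
      Units.map (Algebra.norm K (S := L)) g ^ k := by
    rw [← map_pow, ← map_pow, pow_mul, hm, hk]
    ext
    simpa using hv
  rw [pow_eq_pow_iff_modEq, hord] at hpow
  have hdvd : r ∣ k := ((hpow.of_dvd hK).dvd_iff dvd_rfl).mp (dvd_mul_left r m)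
  obtain ⟨j, rfl⟩ := hdvd
  refine ⟨((g ^ j : Lˣ) : L), ?_⟩
  rw [← Units.val_pow_eq_pow_val, ← pow_mul, mul_comm j r, hk, Units.val_mk0]

theorem Polynomial.irreducible_expand_iff_of_monic_of_finite {K : Type*} [Field K] [Finite K] {r : ℕ}
    (hr : r.Prime) (hK : r ∣ Nat.card K - 1) {Q : K[X]} (hQm : Q.Monic) :
    Irreducible (expand K r Q) ↔
      Irreducible Q ∧ ¬ ∃ v : K, v ^ r = (-1) ^ Q.natDegree * Q.coeff 0 := by
  constructor
  · intro h
    have hQ := of_irreducible_expand hr.ne_zero h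
    refine ⟨hQ, ?_⟩
    have : Fact (Irreducible Q) := ⟨hQ⟩
    have hfd : FiniteDimensional K (AdjoinRoot Q) := (AdjoinRoot.powerBasis hQ.ne_zero).finite
    have hnorm : Algebra.norm K (AdjoinRoot.root Q) = (-1) ^ Q.natDegree * Q.coeff 0 := by
      have := Algebra.PowerBasis.norm_gen_eq_coeff_zero_minpoly
        (AdjoinRoot.powerBasis hQ.ne_zero)
      rwa [AdjoinRoot.minpoly_powerBasis_gen_of_monic hQm, AdjoinRoot.powerBasis_gen,
        AdjoinRoot.powerBasis_dim] at this
    rw [← hnorm, FiniteField.exists_pow_eq_norm_iff hr.ne_zero hK]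
    rintro ⟨y, hy⟩
    have hmin : expand K r Q = minpoly K y := by
      refine minpoly.eq_of_irreducible_of_monic h ?_ (hQm.expand hr.pos)
      rw [expand_aeval, hy, AdjoinRoot.aeval_eq, AdjoinRoot.mk_self]
    have hdeg := minpoly.natDegree_le (A := K) y
    rw [← hmin, natDegree_expand, (AdjoinRoot.powerBasis hQ.ne_zero).finrank,
      AdjoinRoot.powerBasis_dim] at hdeg
    have := hQ.natDegree_pos
    have := hr.two_le
    nlinarith
  · rintro ⟨hQ, hv⟩
    rw [expand_eq_comp_X_pow]
    refine irreducible_comp hQm (monic_X_pow r) hQ fun E _ _ x hx ↦ ?_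
    have hint : IsIntegral K x := by
      by_contra h
      rw [minpoly.eq_zero h] at hx
      exact hQ.ne_zero hx.symm
    have := IntermediateField.adjoin.finiteDimensional hint
    rw [Polynomial.map_pow, map_X]
    refine X_pow_sub_C_irreducible_of_prime hr fun b hb ↦ hv ?_
    have hnorm : Algebra.norm K (IntermediateField.AdjoinSimple.gen K x) =
        (-1) ^ Q.natDegree * Q.coeff 0 := by
      have := Algebra.PowerBasis.norm_gen_eq_coeff_zero_minpoly
        (IntermediateField.adjoin.powerBasis hint)
      rwa [IntermediateField.adjoin.powerBasis_gen, IntermediateField.adjoin.powerBasis_dim,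
        IntermediateField.minpoly_gen, hx] at this
    rw [← hnorm, FiniteField.exists_pow_eq_norm_iff hr.ne_zero hK]
    exact ⟨b, hb⟩

theorem Polynomial.irreducible_expand_iff_of_finite {K : Type*} [Field K] [Finite K] {r : ℕ}
    (hr : r.Prime) (hK : r ∣ Nat.card K - 1) {Q : K[X]} (hQ : Q ≠ 0) :
    Irreducible (expand K r Q) ↔
      Irreducible Q ∧ ¬ ∃ v : K, v ^ r = (-1) ^ Q.natDegree * Q.coeff 0 / Q.leadingCoeff := by
  have hlc : Q.leadingCoeff⁻¹ ≠ 0 := inv_ne_zero (leadingCoeff_ne_zero.mpr hQ)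
  have hunit : IsUnit (C Q.leadingCoeff⁻¹) := isUnit_C.mpr hlc.isUnit
  have := irreducible_expand_iff_of_monic_of_finite hr hK (monic_mul_leadingCoeff_inv hQ)
  rwa [map_mul, expand_C, irreducible_mul_isUnit hunit, irreducible_mul_isUnit hunit,
    natDegree_mul_C hlc, coeff_mul_C, ← mul_assoc, ← div_eq_mul_inv] at this

theorem Polynomial.irreducible_comp_C_mul_X_add_C_iff {K : Type*} [Field K] {a : K} (ha : a ≠ 0)
    (b : K) (P : K[X]) : Irreducible (P.comp (C a * X + C b)) ↔ Irreducible P := by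
  let := invertibleOfNonzero ha
  exact MulEquiv.irreducible_iff (algEquivCMulXAddC a b)

theorem Polynomial.irreducible_comp_unicritical_iff {K : Type*} [Field K] [Finite K] {r : ℕ}
    (hr : r.Prime) (hK : r ∣ Nat.card K - 1) {a : K} (ha : a ≠ 0) (γ c : K) {P : K[X]}
    (hP : P ≠ 0) :
    Irreducible (P.comp (C a * (X - C γ) ^ r + C c)) ↔
      Irreducible P ∧ ¬ ∃ v : K, v ^ r =
        (-1) ^ P.natDegree * P.eval c / (P.leadingCoeff * a ^ P.natDegree) := by
  have hcomp : P.comp (C a * (X - C γ) ^ r + C c) =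
      (expand K r (P.comp (C a * X + C c))).comp (C 1 * X + C (-γ)) := by
    rw [expand_eq_comp_X_pow, comp_assoc, comp_assoc]
    simp [sub_eq_add_neg]
  have hdeg : (C a * X + C c).natDegree = 1 := natDegree_linear ha
  have hlc : (P.comp (C a * X + C c)).leadingCoeff = P.leadingCoeff * a ^ P.natDegree := by
    rw [leadingCoeff_comp (by simp [hdeg]), leadingCoeff_linear ha]
  have hne : P.comp (C a * X + C c) ≠ 0 := by
    rw [← leadingCoeff_ne_zero, hlc]
    exact mul_ne_zero (leadingCoeff_ne_zero.mpr hP) (pow_ne_zero _ ha)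
  rw [hcomp, irreducible_comp_C_mul_X_add_C_iff one_ne_zero,
    irreducible_expand_iff_of_finite hr hK hne, irreducible_comp_C_mul_X_add_C_iff ha, hlc,
    natDegree_comp, hdeg, mul_one, coeff_zero_eq_eval_zero, eval_comp]
  simp

theorem polyIter_succ_eq_comp {K : Type*} [Field K] (f : K[X]) (n : ℕ) :
    polyIter f (n + 1) = (polyIter f n).comp f := by
  induction n with
  | zero => simp [polyIter]
  | succ n ih => rw [polyIter, ih, ← comp_assoc, ← polyIter, ih]

theorem eval_polyIter {K : Type*} [Field K] (f : K[X]) (n : ℕ) (x : K) :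
    (polyIter f n).eval x = (fun t ↦ f.eval t)^[n] x := by
  induction n with
  | zero => simp [polyIter]
  | succ n ih => rw [polyIter, eval_comp, ih, Function.iterate_succ_apply']

theorem natDegree_polyIter {K : Type*} [Field K] (f : K[X]) (n : ℕ) :
    (polyIter f n).natDegree = f.natDegree ^ n := by
  induction n with
  | zero => simp [polyIter]
  | succ n ih => rw [polyIter, natDegree_comp, ih, pow_succ']

theorem exists_pow_eq_div_mul_pow_iff {K : Type*} [Field K] (r : ℕ) (x y : K) {w : K}
    (hw : w ≠ 0) : (∃ v : K, v ^ r = x / (y * w ^ r)) ↔ ∃ v : K, v ^ r = x / y := by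
  constructor
  · rintro ⟨v, hv⟩
    exact ⟨v * w, by rw [mul_pow, hv, ← div_div, div_mul_cancel₀ _ (pow_ne_zero _ hw)]⟩
  · rintro ⟨v, hv⟩
    exact ⟨v / w, by rw [div_pow, hv, div_div]⟩

theorem irreducible_polyIter_succ_iff {K : Type*} [Field K] [Finite K] {r : ℕ}
    (hr : r.Prime) (hK : r ∣ Nat.card K - 1) {a : K} (ha : a ≠ 0) (γ c : K) {f : K[X]}
    (hf : f = C a * (X - C γ) ^ r + C c) {n : ℕ} (hn : n ≠ 0) :
    Irreducible (polyIter f (n + 1)) ↔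
      Irreducible (polyIter f n) ∧ ¬ ∃ v : K, v ^ r = (fun t ↦ f.eval t)^[n + 1] γ / a := by
  have hfeval : f.eval γ = c := by simp [hf, hr.ne_zero]
  have hfdeg : f.natDegree = r := by
    rw [hf, natDegree_add_C, natDegree_C_mul ha, natDegree_pow, natDegree_X_sub_C, mul_one]
  have hflc : f.leadingCoeff = a := by
    rw [leadingCoeff, hfdeg, hf, coeff_add, coeff_C_of_ne_zero hr.ne_zero, add_zero, coeff_C_mul]
    have := (monic_X_sub_C γ).pow r
    rw [Monic, leadingCoeff, natDegree_pow, natDegree_X_sub_C, mul_one] at this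
    rw [this, mul_one]
  have hne (m : ℕ) : polyIter f m ≠ 0 := by
    intro h
    have := natDegree_polyIter f m
    obtain rfl | hm := eq_or_ne m 0
    · exact X_ne_zero h
    · rw [h, natDegree_zero, hfdeg] at this
      exact pow_ne_zero m hr.ne_zero this.symm
  obtain ⟨m, rfl⟩ := Nat.exists_eq_succ_of_ne_zero hn
  have hlc : (polyIter f (m + 1)).leadingCoeff = a * (polyIter f m).leadingCoeff ^ r := by
    rw [polyIter, leadingCoeff_comp, hflc, hfdeg]
    rw [natDegree_polyIter, hfdeg]
    exact pow_ne_zero m hr.ne_zero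
  have hw : (polyIter f m).leadingCoeff * (-a) ^ r ^ m ≠ 0 :=
    mul_ne_zero (leadingCoeff_ne_zero.mpr (hne m)) (pow_ne_zero _ (neg_ne_zero.mpr ha))
  have hsign : ((-1 : K) ^ r ^ (m + 1)) * (-1) ^ r ^ (m + 1) = 1 := by
    rw [← mul_pow]; simp
  rw [Function.iterate_succ_apply, hfeval, ← eval_polyIter, ← exists_pow_eq_div_mul_pow_iff r _ a hw,
    polyIter_succ_eq_comp]
  nth_rw 2 [hf]
  rw [irreducible_comp_unicritical_iff hr hK ha γ c (hne _), natDegree_polyIter, hfdeg, hlc]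
  congr! 5 with v
  rw [mul_pow, ← pow_mul, ← pow_succ, neg_pow a, div_eq_div_iff]
  · linear_combination ((polyIter f (m + 1)).eval c * a * (polyIter f m).leadingCoeff ^ r *
      a ^ r ^ (m + 1)) * hsign
  · exact mul_ne_zero (mul_ne_zero ha (pow_ne_zero _ (leadingCoeff_ne_zero.mpr (hne m))))
      (pow_ne_zero _ ha)
  · exact mul_ne_zero ha (mul_ne_zero (pow_ne_zero _ (leadingCoeff_ne_zero.mpr (hne m)))
      (mul_ne_zero (pow_ne_zero _ (neg_ne_zero.mpr one_ne_zero)) (pow_ne_zero _ ha)))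

theorem stmt0 {K : Type*} [Field K] [Fintype K] {q r : ℕ}
    (hq : Fintype.card K = q) (hr : r.Prime) (hqr : q % r = 1)
    (a γ c : K) (ha : a ≠ 0) (f : K[X])
    (hf : f = C a * (X - C γ) ^ r + C c) :
    (∀ n : ℕ, 0 < n → Irreducible (polyIter f n)) ↔
      ((¬ ∃ v : K, v ^ r = -(f.eval γ) / a) ∧
       ∀ n : ℕ, 2 ≤ n → ¬ ∃ v : K, v ^ r = ((fun t => f.eval t)^[n] γ) / a) := by
  have hK : r ∣ Nat.card K - 1 := by
    rw [Nat.card_eq_fintype_card, hq, ← hqr]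
    exact Nat.dvd_sub_mod q
  have hfirst : Irreducible (polyIter f 1) ↔ ¬ ∃ v : K, v ^ r = -(f.eval γ) / a := by
    have hfeval : f.eval γ = c := by simp [hf, hr.ne_zero]
    rw [hfeval, polyIter, polyIter, comp_X, hf]
    simpa [irreducible_X] using
      irreducible_comp_unicritical_iff hr hK ha γ c (P := X) X_ne_zero
  have hstep (n : ℕ) (hn : n ≠ 0) := irreducible_polyIter_succ_iff hr hK ha γ c hf hn
  constructor
  · refine fun h ↦ ⟨hfirst.mp (h 1 one_pos), fun n hn ↦ ?_⟩
    obtain ⟨m, rfl⟩ := Nat.exists_eq_add_of_le' hn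
    exact ((hstep (m + 1) m.succ_ne_zero).mp (h (m + 2) (by lia))).2
  · rintro ⟨h₁, h₂⟩ n hn
    induction n, hn using Nat.le_induction with
    | base => exact hfirst.mpr h₁
    | succ n hn ih => exact (hstep n (by lia)).mpr ⟨ih, h₂ (n + 1) (by lia)⟩
end

section
/- Let K be a field whose characteristic is relatively prime to d (i.e., char K = 0 or char K does not divide d), where d ≥ 2, and let h(x) = a·x^d + c ∈ K[x] with a ≠ 0. Let g ∈ K[x] have degree k ≥ 1 and leading coefficient ℓ. Fix n ≥ 1 and suppose g ∘ h^{n−1} is irreducible over K. Set C = (−a)^k·ℓ if n = 1 and C = a^k·ℓ if n > 1; set D = (4a)^k·ℓ if n = 1 and D = a^k·ℓ if n > 1. If (g ∘ h^{n−1})(c)/C is not an r-th power in K for every prime r dividing d, and, in case 4 divides d, (g ∘ h^{n−1})(c)/D is not a 4-th power in K, then g ∘ h^n is irreducible over K. -/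
open Polynomial

/-- If `x` is a square root of a nonsquare `a`, then `1, x` are linearly independent. -/
theorem eq_zero_of_add_mul_sqrt_eq_zero {K L : Type*} [Field K] [Field L] [Algebra K L]
    {a : K} {x : L} (hx : x ^ 2 = algebraMap K L a) (ha : ∀ b : K, b ^ 2 ≠ a)
    {p q : K} (h : algebraMap K L p + algebraMap K L q * x = 0) : p = 0 ∧ q = 0 := by
  have hq : q = 0 := by
    by_contra hq
    apply ha (p / q)
    apply (algebraMap K L).injective
    have hq' : algebraMap K L q ≠ 0 := by simpa using hq
    rw [← hx, map_pow, map_div₀]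
    have hxq : x = -(algebraMap K L p / algebraMap K L q) := by
      field_simp
      linear_combination h
    rw [hxq, neg_sq]
  subst hq
  simpa using h

/-- A square root `x` of `a` is not a square in `K(x)` if `a` is neither a square nor of the form
`-4 * b ^ 4` in `K`. -/
theorem sq_ne_of_sq_eq {K L : Type*} [Field K] [Field L] [Algebra K L]
    {a : K} {x : L} (hx : x ^ 2 = algebraMap K L a)
    (hL : ∀ y : L, ∃ u v : K, y = algebraMap K L u + algebraMap K L v * x)
    (ha : ∀ b : K, b ^ 2 ≠ a) (ha4 : ∀ b : K, -4 * b ^ 4 ≠ a) (y : L) : y ^ 2 ≠ x := by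
  intro hy
  obtain ⟨u, v, rfl⟩ := hL y
  obtain ⟨h₁, h₂⟩ := eq_zero_of_add_mul_sqrt_eq_zero (p := u ^ 2 + v ^ 2 * a) (q := 2 * u * v - 1)
    hx ha (by
      simp only [map_add, map_sub, map_mul, map_pow, map_ofNat, map_one]
      linear_combination hy - (algebraMap K L v) ^ 2 * hx)
  apply ha4 u
  linear_combination (-4 * u ^ 2) * h₁ + a * (2 * u * v + 1) * h₂

/-- A square root `x` of `a` is not of the form `-4 * y ^ 4` in `K(x)` if `a` is neither a square
nor of the form `-4 * b ^ 4` in `K`. -/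
theorem neg_four_mul_pow_four_ne_of_sq_eq {K L : Type*} [Field K] [Field L] [Algebra K L]
    {a : K} {x : L} (hx : x ^ 2 = algebraMap K L a)
    (hL : ∀ y : L, ∃ u v : K, y = algebraMap K L u + algebraMap K L v * x)
    (ha : ∀ b : K, b ^ 2 ≠ a) (ha4 : ∀ b : K, -4 * b ^ 4 ≠ a) (y : L) : -4 * y ^ 4 ≠ x := by
  intro hy
  obtain ⟨p, q, hpq⟩ := hL (y ^ 2)
  have hy' : -4 * (algebraMap K L p + algebraMap K L q * x) ^ 2 = x := by
    rw [← hpq, ← hy]; ring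
  obtain ⟨h₁, h₂⟩ := eq_zero_of_add_mul_sqrt_eq_zero
    (p := -4 * (p ^ 2 + q ^ 2 * a)) (q := -8 * p * q - 1) hx ha (by
      simp only [map_add, map_sub, map_mul, map_pow, map_neg, map_ofNat, map_one]
      linear_combination hy' + 4 * (algebraMap K L q) ^ 2 * hx)
  have h₃ : -8 * p * q = 1 := by linear_combination h₂
  have hp : p ≠ 0 := by rintro rfl; simp at h₃
  have hq : q ≠ 0 := by rintro rfl; simp at h₃
  have h4 : (4 : K) ≠ 0 := fun h4 ↦ by
    have : (0 : K) = 1 := by linear_combination h₃ + 2 * p * q * h4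
    exact zero_ne_one this
  have h₄ : p ^ 2 + q ^ 2 * a = 0 := by simpa [h4] using h₁
  have hpL : algebraMap K L p ≠ 0 := by simpa using hp
  have h₄' : algebraMap K L p ^ 2 + algebraMap K L q ^ 2 * x ^ 2 = 0 := by
    rw [hx]; simpa using congrArg (algebraMap K L) h₄
  apply sq_ne_of_sq_eq hx hL ha ha4 (2 * (algebraMap K L q * x / algebraMap K L p) * y ^ 2)
  field_simp
  linear_combination (-4 * y ^ 4 * -1) * h₄' + algebraMap K L p ^ 2 * hy

/-- The `2`-power case of the Vahlen–Capelli theorem. -/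
theorem X_pow_two_pow_sub_C_irreducible {K : Type*} [Field K] (s : ℕ) {a : K}
    (ha : ∀ b : K, b ^ 2 ≠ a) (ha4 : ∀ b : K, -4 * b ^ 4 ≠ a) :
    Irreducible (X ^ 2 ^ s - C a : K[X]) := by
  induction s generalizing K a with
  | zero => simpa using irreducible_X_sub_C a
  | succ s ih =>
    rw [pow_succ]
    apply X_pow_mul_sub_C_irreducible (X_pow_sub_C_irreducible_of_prime Nat.prime_two ha)
    intro E _ _ x hx
    have hint : IsIntegral K x := minpoly.ne_zero_iff.mp (hx ▸ X_pow_sub_C_ne_zero two_pos a)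
    have hgen : (IntermediateField.AdjoinSimple.gen K x) ^ 2 = algebraMap K _ a := by
      have h := minpoly.aeval K (IntermediateField.AdjoinSimple.gen K x)
      rw [IntermediateField.minpoly_gen, hx] at h
      simpa [sub_eq_zero] using h
    have hL (y : IntermediateField.adjoin K {x}) : ∃ u v : K,
        y = algebraMap K _ u + algebraMap K _ v * IntermediateField.AdjoinSimple.gen K x := by
      obtain ⟨f, hf, hy⟩ := (IntermediateField.adjoin.powerBasis hint).exists_eq_aeval y
      rw [IntermediateField.adjoin.powerBasis_dim, hx, natDegree_X_pow_sub_C] at hf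
      obtain ⟨v, u, rfl⟩ := exists_eq_X_add_C_of_natDegree_le_one (Nat.le_of_lt_succ hf)
      refine ⟨u, v, ?_⟩
      simpa [add_comm] using hy
    exact ih (sq_ne_of_sq_eq hgen hL ha ha4) (neg_four_mul_pow_four_ne_of_sq_eq hgen hL ha ha4)

theorem X_pow_mul_sub_C_irreducible_of_coprime {K : Type*} [Field K] {m n : ℕ} {a : K}
    (hmn : m.Coprime n) (hm : Irreducible (X ^ m - C a : K[X]))
    (hn : Irreducible (X ^ n - C a : K[X])) : Irreducible (X ^ (m * n) - C a : K[X]) := by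
  have hm0 := Nat.pos_of_ne_zero (ne_zero_of_irreducible_X_pow_sub_C hm)
  have hn0 := Nat.pos_of_ne_zero (ne_zero_of_irreducible_X_pow_sub_C hn)
  have hmn0 : 0 < m * n := Nat.mul_pos hm0 hn0
  have hne : (X ^ (m * n) - C a : K[X]) ≠ 0 := X_pow_sub_C_ne_zero hmn0 a
  have hunit : ¬ IsUnit (X ^ (m * n) - C a : K[X]) := by
    rw [isUnit_iff_degree_eq_zero, degree_X_pow_sub_C hmn0, Nat.cast_eq_zero]
    exact hmn0.ne'
  obtain ⟨p, hp, hpd⟩ := WfDvdMonoid.exists_irreducible_factor hunit hne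
  have : Fact (Irreducible p) := ⟨hp⟩
  let pb := AdjoinRoot.powerBasis hp.ne_zero
  have : Module.Finite K (AdjoinRoot p) := pb.finite
  have hfin : Module.finrank K (AdjoinRoot p) = p.natDegree := by
    rw [pb.finrank, AdjoinRoot.powerBasis_dim]
  have hroot : AdjoinRoot.root p ^ (m * n) = algebraMap K (AdjoinRoot p) a := by
    have h := eval₂_eq_zero_of_dvd_of_eval₂_eq_zero _ _ hpd (AdjoinRoot.eval₂_root p)
    rwa [eval₂_sub, eval₂_pow, eval₂_C, eval₂_X, sub_eq_zero] at h
  have hdvd {i : ℕ} {y : AdjoinRoot p} (hi0 : 0 < i) (hi : Irreducible (X ^ i - C a : K[X]))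
      (hy : y ^ i = algebraMap K _ a) : i ∣ p.natDegree := by
    have hmin : X ^ i - C a = minpoly K y := minpoly.eq_of_irreducible_of_monic hi
      (by simp [hy]) (monic_X_pow_sub_C a hi0.ne')
    have h := minpoly.degree_dvd (K := K) (x := y) (Algebra.IsIntegral.isIntegral y)
    rwa [← hmin, natDegree_X_pow_sub_C, hfin] at h
  have hmnd : m * n ∣ p.natDegree := hmn.mul_dvd_of_dvd_of_dvd
    (hdvd hm0 hm (y := AdjoinRoot.root p ^ n) (by rw [← pow_mul, mul_comm, hroot]))
    (hdvd hn0 hn (y := AdjoinRoot.root p ^ m) (by rw [← pow_mul, hroot]))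
  refine (associated_of_dvd_of_natDegree_le hpd hne ?_).irreducible hp
  rw [natDegree_X_pow_sub_C]
  exact Nat.le_of_dvd hp.natDegree_pos hmnd

/-- The Vahlen–Capelli theorem. -/
theorem X_pow_sub_C_irreducible_of_forall_prime {K : Type*} [Field K] {n : ℕ} (hn : n ≠ 0) {a : K}
    (ha : ∀ p : ℕ, p.Prime → p ∣ n → ∀ b : K, b ^ p ≠ a)
    (ha4 : 4 ∣ n → ∀ b : K, -4 * b ^ 4 ≠ a) : Irreducible (X ^ n - C a : K[X]) := by
  obtain ⟨s, m, hm, rfl⟩ := Nat.exists_eq_two_pow_mul_odd hn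
  refine X_pow_mul_sub_C_irreducible_of_coprime (hm.coprime_two_left.pow_left s) ?_
    (X_pow_sub_C_irreducible_of_odd hm fun p hp hpm ↦ ha p hp (hpm.mul_left _))
  match s, ha, ha4 with
  | 0, _, _ => simpa using irreducible_X_sub_C a
  | 1, ha, _ =>
    simpa using X_pow_sub_C_irreducible_of_prime Nat.prime_two
      (ha 2 Nat.prime_two (by simp))
  | s + 2, ha, ha4 =>
    exact X_pow_two_pow_sub_C_irreducible _
      (ha 2 Nat.prime_two ((dvd_pow_self 2 (by omega)).mul_right m))
      (ha4 ((Dvd.intro_left (2 ^ s) (by ring)).mul_right m))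

/-- A criterion for the irreducibility of `F(X ^ d)` in terms of the norm of a root of `F`. -/
theorem irreducible_comp_X_pow {K : Type*} [Field K] {F : K[X]} (hF : Irreducible F) {d : ℕ}
    (hd : d ≠ 0)
    (hpow : ∀ r : ℕ, r.Prime → r ∣ d →
      ∀ v : K, v ^ r ≠ (-1) ^ F.natDegree * F.coeff 0 / F.leadingCoeff)
    (hpow4 : 4 ∣ d →
      ∀ v : K, (-4) ^ F.natDegree * v ^ 4 ≠ (-1) ^ F.natDegree * F.coeff 0 / F.leadingCoeff) :
    Irreducible (F.comp (X ^ d)) := by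
  have hu : IsUnit (C F.leadingCoeff⁻¹) := by
    simpa [isUnit_C] using hF.ne_zero
  suffices h : Irreducible ((F * C F.leadingCoeff⁻¹).comp (X ^ d)) by
    rw [mul_comp, C_comp] at h
    exact (irreducible_mul_isUnit hu).mp h
  have hmonic := monic_mul_leadingCoeff_inv hF.ne_zero
  refine irreducible_comp hmonic (monic_X_pow d)
    ((irreducible_mul_isUnit hu).mpr hF) fun E _ _ x hx ↦ ?_
  have hint : IsIntegral K x := minpoly.ne_zero_iff.mp (hx ▸ hmonic.ne_zero)
  have hdeg : (minpoly K x).natDegree = F.natDegree := by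
    rw [hx, natDegree_mul_leadingCoeff_inv _ hF.ne_zero]
  have hnorm : Algebra.norm K (IntermediateField.AdjoinSimple.gen K x) =
      (-1) ^ F.natDegree * F.coeff 0 / F.leadingCoeff := by
    rw [← IntermediateField.adjoin.powerBasis_gen hint,
      Algebra.PowerBasis.norm_gen_eq_coeff_zero_minpoly,
      IntermediateField.adjoin.powerBasis_gen, IntermediateField.minpoly_gen,
      IntermediateField.adjoin.powerBasis_dim, hdeg, hx, coeff_mul_C]
    ring
  rw [Polynomial.map_pow, map_X]
  refine X_pow_sub_C_irreducible_of_forall_prime hd (fun r hr hrd b hb ↦ ?_) fun h4 b hb ↦ ?_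
  · apply hpow r hr hrd (Algebra.norm K b)
    rw [← map_pow, hb, hnorm]
  · apply hpow4 h4 (Algebra.norm K b)
    rw [← hnorm, ← hb, map_mul, map_pow, ← hdeg, ← IntermediateField.adjoin.finrank hint,
      ← Algebra.norm_algebraMap, map_neg, map_ofNat]

theorem exists_leadingCoeff_polyIter_mul_pow {K : Type*} [Field K] (f : K[X])
    (hf : f.natDegree ≠ 0) (n : ℕ) :
    ∃ e, (polyIter f n).leadingCoeff * f.leadingCoeff ^ f.natDegree ^ n =
      f.leadingCoeff ^ (1 + f.natDegree * e) ∧ (n = 0 → e = 0) := by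
  induction n with
  | zero => exact ⟨0, by simp [polyIter]⟩
  | succ n ih =>
    obtain ⟨e, he, -⟩ := ih
    refine ⟨1 + f.natDegree * e, ?_, by simp⟩
    rw [polyIter, leadingCoeff_comp (by rw [natDegree_polyIter]; exact pow_ne_zero n hf), pow_succ,
      pow_mul, mul_assoc, ← mul_pow, he, ← pow_mul, pow_add, pow_one, mul_comm (1 + _)]

theorem stmt2 {K : Type*} [Field K] {d k n : ℕ} (hd : 2 ≤ d)
    (hchar : ¬ (ringChar K : ℕ) ∣ d)
    (a c : K) (ha : a ≠ 0) (h : K[X]) (hh : h = C a * X ^ d + C c)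
    (g : K[X]) (hgk : g.natDegree = k) (hk : 1 ≤ k)
    (hn : 1 ≤ n)
    (hprev : Irreducible (g.comp (polyIter h (n - 1))))
    (hrpow : ∀ r : ℕ, r.Prime → r ∣ d →
        ¬ ∃ v : K, v ^ r = (g.comp (polyIter h (n - 1))).eval c /
          (if n = 1 then (-a) ^ k * g.leadingCoeff else a ^ k * g.leadingCoeff))
    (h4pow : 4 ∣ d →
        ¬ ∃ v : K, v ^ 4 = (g.comp (polyIter h (n - 1))).eval c /
          (if n = 1 then (4 * a) ^ k * g.leadingCoeff else a ^ k * g.leadingCoeff)) :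
    Irreducible (g.comp (polyIter h n)) := by
  obtain ⟨j, rfl⟩ : ∃ j, n = j + 1 := ⟨n - 1, by omega⟩
  simp only [Nat.add_sub_cancel, Nat.add_eq_right] at hprev hrpow h4pow
  have hd0 : d ≠ 0 := by omega
  have hg0 : g.leadingCoeff ≠ 0 := by
    rw [leadingCoeff_ne_zero]; rintro rfl; simp at hgk; omega
  have hhdeg : h.natDegree = d := by
    rw [hh, natDegree_add_C, natDegree_C_mul_X_pow d a ha]
  have hhlc : h.leadingCoeff = a := by
    rw [leadingCoeff, hhdeg, hh]; simp [hd0, coeff_C]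
  obtain ⟨e, he, he0⟩ := exists_leadingCoeff_polyIter_mul_pow h (by omega) j
  rw [hhdeg, hhlc] at he
  set f := g.comp (polyIter h j) with hf
  have hlin : (C a * X + C c).natDegree = 1 := natDegree_linear ha
  have hfdeg : f.natDegree = k * d ^ j := by
    rw [hf, natDegree_comp, natDegree_polyIter, hgk, hhdeg]
  have hflc : f.leadingCoeff = g.leadingCoeff * (polyIter h j).leadingCoeff ^ k := by
    rw [hf, leadingCoeff_comp (by rw [natDegree_polyIter, hhdeg]; exact pow_ne_zero j hd0), hgk]
  have hcomp : g.comp (polyIter h (j + 1)) = (f.comp (C a * X + C c)).comp (X ^ d) := by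
    have hh' : (C a * X + C c).comp (X ^ d) = h := by simp [hh]
    rw [polyIter_succ_eq_comp, ← comp_assoc, comp_assoc f, hh']
  have hFdeg : (f.comp (C a * X + C c)).natDegree = k * d ^ j := by
    rw [natDegree_comp, hlin, hfdeg, mul_one]
  have hFlc : (f.comp (C a * X + C c)).leadingCoeff = a ^ k * g.leadingCoeff * (a ^ (k * e)) ^ d := by
    rw [leadingCoeff_comp (by omega), hfdeg, leadingCoeff_linear ha, hflc, mul_comm k (d ^ j),
      pow_mul, mul_assoc, ← mul_pow, he]
    ring
  have hF0 : (f.comp (C a * X + C c)).coeff 0 = f.eval c := by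
    simp [coeff_zero_eq_eval_zero, eval_comp]
  have hF : Irreducible (f.comp (C a * X + C c)) := by
    let := invertibleOfNonzero ha
    exact (MulEquiv.irreducible_iff (algEquivCMulXAddC a c)).mpr hprev
  rw [hcomp]
  apply irreducible_comp_X_pow hF hd0
  · intro r hr hrd v hv
    rw [hFdeg, hF0, hFlc] at hv
    apply hrpow r hr hrd
    obtain rfl | hj := eq_or_ne j 0
    · refine ⟨v, ?_⟩
      rw [hv, he0 rfl, if_pos rfl, neg_pow a]
      rcases neg_one_pow_eq_or K k with h1 | h1 <;> simp [h1, neg_div, div_neg]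
    · obtain ⟨t, ht⟩ := hrd
      have hsign : ((-1 : K) ^ (k * d ^ j)) ^ r = (-1) ^ (k * d ^ j) := by
        rcases hr.eq_two_or_odd' with rfl | hodd
        · have : Even (k * d ^ j) := by
            simp [Nat.even_pow, hj, ht]
          simp [this.neg_one_pow]
        · rcases neg_one_pow_eq_or K (k * d ^ j) with h1 | h1 <;> simp [h1, hodd.neg_one_pow]
      refine ⟨(-1) ^ (k * d ^ j) * v * (a ^ (k * e)) ^ t, ?_⟩
      have hA : (a ^ (k * e)) ^ d ≠ 0 := pow_ne_zero _ (pow_ne_zero _ ha)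
      have hone : (-1 : K) ^ (k * d ^ j) * (-1) ^ (k * d ^ j) = 1 := by
        rw [← mul_pow]; simp
      rw [if_neg hj, mul_pow, mul_pow, hsign, hv, ← pow_mul _ t, mul_comm t, ← ht]
      field_simp
      linear_combination f.eval c * hone
  · intro h4 v hv
    rw [hFdeg, hF0, hFlc] at hv
    apply h4pow h4
    obtain rfl | hj := eq_or_ne j 0
    · have h4K : (4 : K) ≠ 0 := fun h0 ↦
        hchar ((ringChar.dvd (R := K) (x := 4) (by exact_mod_cast h0)).trans h4)
      refine ⟨v, ?_⟩
      rw [he0 rfl, neg_pow (4 : K), pow_zero, mul_one, mul_zero, pow_zero, one_pow, mul_one,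
        mul_div_assoc, mul_assoc] at hv
      have hv' := mul_left_cancel₀ (pow_ne_zero k (neg_ne_zero.mpr one_ne_zero)) hv
      rw [if_pos rfl, mul_pow, mul_assoc, mul_comm (4 ^ k), ← div_div, ← hv']
      field_simp
    · obtain ⟨t, ht⟩ := h4
      obtain ⟨w, hw⟩ : 4 ∣ k * d ^ j :=
        ((Dvd.intro t ht.symm).trans (dvd_pow_self d hj)).mul_left k
      have hone : (-1 : K) ^ (k * d ^ j) = 1 := by
        rw [hw]; exact Even.neg_one_pow ⟨2 * w, by ring⟩
      refine ⟨(-4) ^ w * v * (a ^ (k * e)) ^ t, ?_⟩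
      have hA : (a ^ (k * e)) ^ d ≠ 0 := pow_ne_zero _ (pow_ne_zero _ ha)
      rw [if_neg hj, mul_pow, mul_pow, ← pow_mul, mul_comm w, ← hw, hv, hone, ← pow_mul _ t,
        mul_comm t, ← ht]
      field_simp
end

section
/- Let K be a field and let f ∈ K[x] be a polynomial of degree d ≥ 1 whose leading coefficient a_d satisfies a_d = c^{d−1} for some nonzero c ∈ K. Define g(x) = c·f(x/c). Then g is monic, and for every positive integer n, the n-fold composition f^n is irreducible over K if and only if the n-fold composition g^n is irreducible over K. -/
open Polynomial

/-- Iteration commutes with conjugation by a scaling. -/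
theorem polyIter_conj_scaling {K : Type*} [Field K] (f : K[X]) {c : K} (hc : c ≠ 0) (n : ℕ) :
    polyIter (C c * f.comp (C c⁻¹ * X)) n = C c * (polyIter f n).comp (C c⁻¹ * X) := by
  induction n with
  | zero => simp [polyIter, ← mul_assoc, ← C_mul, hc]
  | succ n ih =>
    rw [polyIter, ih, polyIter]
    simp [comp_assoc, ← mul_assoc, ← C_mul, hc]

theorem irreducible_C_mul_comp_C_inv_mul_X_iff {K : Type*} [Field K] (p : K[X]) {c : K}
    (hc : c ≠ 0) : Irreducible (C c * p.comp (C c⁻¹ * X)) ↔ Irreducible p := by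
  have hu : IsUnit (C c) := isUnit_C.mpr hc.isUnit
  have h₁ : (C c * X : K[X]).comp (C c⁻¹ * X) = X := by simp [← mul_assoc, ← C_mul, hc]
  have h₂ : (C c⁻¹ * X : K[X]).comp (C c * X) = X := by simp [← mul_assoc, ← C_mul, hc]
  rw [irreducible_isUnit_mul hu]
  exact MulEquiv.irreducible_iff (algEquivOfCompEqX (C c⁻¹ * X) (C c * X) h₂ h₁)

theorem stmt5 {K : Type*} [Field K] {d : ℕ} (hd : 1 ≤ d) (f : K[X])
    (hdeg : f.natDegree = d) (c : K) (hc : c ≠ 0)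
    (hlead : f.leadingCoeff = c ^ (d - 1))
    (g : K[X]) (hg : g = C c * f.comp (C c⁻¹ * X)) :
    g.Monic ∧
    ∀ n : ℕ, 0 < n → (Irreducible (polyIter f n) ↔ Irreducible (polyIter g n)) := by
  subst hg
  refine ⟨?_, fun n _ => ?_⟩
  · have hX : (C c⁻¹ * X : K[X]).natDegree ≠ 0 := by simp [hc]
    rw [Monic, leadingCoeff_mul, leadingCoeff_C, leadingCoeff_comp hX, hlead, hdeg,
      leadingCoeff_C_mul_X, ← mul_assoc, mul_pow_sub_one (by omega), ← mul_pow,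
      mul_inv_cancel₀ hc, one_pow]
  · rw [polyIter_conj_scaling f hc, irreducible_C_mul_comp_C_inv_mul_X_iff _ hc]
end

section
/- Let F_{q^s} be a finite extension of the finite field F_q, let α ∈ F_{q^s}, and let r > 0 be an integer with q ≡ 1 (mod r). If the field norm N_{F_{q^s}/F_q}(α) is an r-th power in F_q, then α is an r-th power in F_{q^s}. -/
/-- In a finite cyclic group of order `n * r`, every element killed by `n` is an `r`-th power. -/
theorem IsCyclic.exists_pow_eq_of_pow_eq_one {G : Type*} [Group G] [Finite G] [IsCyclic G]
    {n r : ℕ} (hcard : Nat.card G = n * r) {a : G} (ha : a ^ n = 1) : ∃ b : G, b ^ r = a := by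
  obtain ⟨g, hg⟩ := IsCyclic.exists_generator (α := G)
  obtain ⟨k, rfl⟩ := mem_powers_iff_mem_zpowers.mpr (hg a)
  have hn : 0 < n := Nat.pos_of_mul_pos_right (hcard ▸ Nat.card_pos)
  have hdvd : n * r ∣ n * k := by
    rw [← hcard, ← orderOf_eq_card_of_forall_mem_zpowers hg, orderOf_dvd_iff_pow_eq_one,
      mul_comm, pow_mul]
    exact ha
  obtain ⟨j, rfl⟩ := Nat.dvd_of_mul_dvd_mul_left hn hdvd
  exact ⟨g ^ j, by simp only [← pow_mul, mul_comm]⟩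

/-- in a finite extension of finite fields with `q ≡ 1 (mod r)`,
if the norm of `α` is an `r`-th power in the base field then `α` is an `r`-th power. -/
theorem stmt7 {K L : Type*} [Field K] [Field L] [Algebra K L]
    [Fintype K] [Fintype L] [FiniteDimensional K L]
    (r : ℕ) (hr : 0 < r) (hcong : Fintype.card K % r = 1)
    (α : L) (hnorm : ∃ w : K, w ^ r = Algebra.norm K α) :
    ∃ v : L, v ^ r = α := by
  obtain ⟨w, hw⟩ := hnorm
  rcases eq_or_ne α 0 with rfl | hα
  · exact ⟨0, zero_pow hr.ne'⟩
  have hw0 : w ≠ 0 := by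
    rintro rfl
    rw [zero_pow hr.ne'] at hw
    exact hα (Algebra.norm_eq_zero_iff.mp hw.symm)
  obtain ⟨m, hm⟩ : r ∣ Fintype.card K - 1 := hcong ▸ Nat.dvd_sub_mod _
  set M := (Nat.card L - 1) / (Nat.card K - 1) with hM
  have hML : M * (Fintype.card K - 1) = Fintype.card L - 1 := by
    rw [hM, Nat.card_eq_fintype_card, Nat.card_eq_fintype_card]
    refine Nat.div_mul_cancel ?_
    rw [Module.card_eq_pow_finrank (K := K) (V := L)]
    exact Nat.sub_one_dvd_pow_sub_one _ _
  have hpow : α ^ (M * m) = 1 := by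
    rw [pow_mul, hM, ← FiniteField.algebraMap_norm_eq_pow (K := K), ← hw, ← map_pow, ← pow_mul,
      ← hm, FiniteField.pow_card_sub_one_eq_one w hw0, map_one]
  obtain ⟨v, hv⟩ := IsCyclic.exists_pow_eq_of_pow_eq_one (G := Lˣ) (n := M * m) (r := r)
    (a := Units.mk0 α hα)
    (by rw [Nat.card_units, Nat.card_eq_fintype_card, ← hML, hm]; ring)
    (Units.ext (by simpa using hpow))
  exact ⟨v, by simpa using congrArg Units.val hv⟩
end

section
/- Let p ≥ 3 be a prime and q = p^s for a positive integer s. If f(x) = a_p·x^p − a₁·x − a₀ ∈ F_q[x] with a_p ≠ 0 and a₁ ≠ 0, then the second iterate f² = f ∘ f is not irreducible over F_q. -/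
open Polynomial

section FrobeniusDifferences

variable {K E : Type*} [Field K] [Field E] [Algebra K E]

/-- If the power map `x ↦ x ^ p ^ s` is a `K`-algebra endomorphism whose `p ^ k`-th iterate is the
identity, then it fixes every root of `a X ^ p - b X`. -/
theorem map_eq_self_of_mul_pow_eq_mul {p s k : ℕ} (φ : E →ₐ[K] E)
    (hφ : ∀ x, φ x = x ^ p ^ s) (hk : ∀ x, (φ ^ p ^ k) x = x) {a b : K} (hb : b ≠ 0)
    {w : E} (hw : algebraMap K E a * w ^ p = algebraMap K E b * w) : φ w = w := by
  by_cases hw0 : w = 0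
  · simp [hw0]
  have hb' : algebraMap K E b ≠ 0 := by simpa using hb
  have hφw : algebraMap K E a * φ w ^ p = algebraMap K E b * φ w := by
    simpa using congrArg φ hw
  obtain ⟨c, hc⟩ : ∃ c, φ w = c * w := ⟨φ w / w, by field_simp⟩
  have hcp : c ^ p = c := by
    rw [hc, mul_pow] at hφw
    have h : (algebraMap K E b * w) * c ^ p = (algebraMap K E b * w) * c := by
      linear_combination hφw - c ^ p * hw
    exact mul_left_cancel₀ (mul_ne_zero hb' hw0) h
  have hcpow (n : ℕ) : c ^ p ^ n = c := by
    induction n with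
    | zero => simp
    | succ n ih => rw [pow_succ, pow_mul, ih, hcp]
  have hiter (n : ℕ) : (φ ^ n) w = c ^ n * w := by
    induction n with
    | zero => simp
    | succ n ih =>
      rw [pow_succ', AlgHom.mul_apply, ih, map_mul, map_pow, hφ c, hcpow, hc]
      ring
  have h := hiter (p ^ k)
  rw [hk, hcpow] at h
  rw [hc, ← h]

/-- If the third difference of `x` under `φ` vanishes, then the iterates of `x` are quadratic
in the number of iterations. -/
theorem pow_apply_eq_add_choose_two (φ : E →ₐ[K] E) {x y z : E} (hx : φ x = x + y)
    (hy : φ y = y + z) (hz : φ z = z) (n : ℕ) :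
    (φ ^ n) x = x + n * y + (n.choose 2 : ℕ) * z := by
  induction n with
  | zero => simp
  | succ n ih =>
    rw [pow_succ', AlgHom.mul_apply, ih, Nat.choose_succ_succ' n 1]
    simp only [map_add, map_mul, map_natCast, hx, hy, hz, Nat.choose_one_right]
    push_cast
    ring

end FrobeniusDifferences

theorem stmt11 {K : Type*} [Field K] [Fintype K] {p s : ℕ}
    (hp : p.Prime) (hp3 : 3 ≤ p) (hs : 0 < s) (hcard : Fintype.card K = p ^ s)
    (aₚ a₁ a₀ : K) (hap : aₚ ≠ 0) (ha1 : a₁ ≠ 0)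
    (f : K[X]) (hf : f = C aₚ * X ^ p - C a₁ * X - C a₀) :
    ¬ Irreducible (polyIter f 2) := by
  intro hirr
  have : Fact p.Prime := ⟨hp⟩
  have : CharP K p := charP_of_card_eq_prime_pow hcard
  have hg : polyIter f 2 = f.comp f := by simp [polyIter]
  rw [hg] at hirr
  have hdeg : f.natDegree = p := by
    rw [hf]
    compute_degree!
    · simpa [hp.ne_zero, hp.ne_one] using hap
    · omega
    · omega
  have : Fact (Irreducible (f.comp f)) := ⟨hirr⟩
  let pb := AdjoinRoot.powerBasis hirr.ne_zero
  have hrank : Module.finrank K (AdjoinRoot (f.comp f)) = p ^ 2 := by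
    rw [pb.finrank, AdjoinRoot.powerBasis_dim, natDegree_comp, hdeg, sq]
  have : FiniteDimensional K (AdjoinRoot (f.comp f)) := pb.finite
  have : Finite (AdjoinRoot (f.comp f)) := Module.finite_of_finite K
  have : CharP (AdjoinRoot (f.comp f)) p := charP_of_injective_algebraMap
    (algebraMap K (AdjoinRoot (f.comp f))).injective p
  set φ := FiniteField.frobeniusAlgHom K (AdjoinRoot (f.comp f)) with hφdef
  have hφ (x : AdjoinRoot (f.comp f)) : φ x = x ^ p ^ s := by simp [hφdef, hcard]
  have horder : orderOf φ = p ^ 2 := by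
    rw [hφdef, FiniteField.orderOf_frobeniusAlgHom, hrank]
  have hfix (x : AdjoinRoot (f.comp f)) : (φ ^ p ^ 2) x = x := by
    rw [← horder, pow_orderOf_eq_one, AlgHom.one_apply]
  set a := algebraMap K (AdjoinRoot (f.comp f)) aₚ with ha
  set b := algebraMap K (AdjoinRoot (f.comp f)) a₁ with hb
  set c := algebraMap K (AdjoinRoot (f.comp f)) a₀ with hc
  have haeval (x : AdjoinRoot (f.comp f)) : aeval x f = a * x ^ p - b * x - c := by
    simp [hf, ha, hb, hc]
  have hsub (x y : AdjoinRoot (f.comp f)) :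
      aeval x f - aeval y f = a * (x - y) ^ p - b * (x - y) := by
    rw [haeval, haeval, sub_pow_char]
    ring
  have hkernel {w : AdjoinRoot (f.comp f)} (hw : a * w ^ p - b * w = 0) : φ w = w :=
    map_eq_self_of_mul_pow_eq_mul φ hφ hfix ha1 (sub_eq_zero.mp hw)
  set α := AdjoinRoot.root (f.comp f) with hα
  have hroot : aeval (aeval α f) f = 0 := by
    rw [← aeval_comp, hα, AdjoinRoot.aeval_eq, AdjoinRoot.mk_self]
  have hφα : aeval (aeval (φ α) f) f = 0 := by
    rw [aeval_algHom_apply φ α f, aeval_algHom_apply φ (aeval α f) f, hroot, map_zero]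
  have hβ : φ (a * (φ α - α) ^ p - b * (φ α - α)) = a * (φ α - α) ^ p - b * (φ α - α) := by
    apply hkernel
    rw [← hsub (φ α) α, ← hsub, hφα, hroot, sub_zero]
  have hγ : φ (φ (φ α - α) - (φ α - α)) = φ (φ α - α) - (φ α - α) := by
    apply hkernel
    rw [map_sub, map_mul, map_mul, map_pow, ha, hb, AlgHom.commutes, AlgHom.commutes] at hβ
    rw [sub_pow_char]
    linear_combination hβ
  have hp_fix : (φ ^ p) α = α := by
    rw [pow_apply_eq_add_choose_two φ (add_sub_cancel α (φ α)).symm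
      (add_sub_cancel (φ α - α) (φ (φ α - α))).symm hγ]
    have h2 : ((p.choose 2 : ℕ) : AdjoinRoot (f.comp f)) = 0 :=
      (CharP.cast_eq_zero_iff _ p _).mpr (hp.dvd_choose_self two_ne_zero (by omega))
    simp [h2]
  have hone : φ ^ p = 1 := AdjoinRoot.algHom_ext hp_fix
  have hdvd := orderOf_dvd_of_pow_eq_one hone
  rw [horder] at hdvd
  have := Nat.le_of_dvd hp.pos hdvd
  nlinarith
end

section
/- Let q = 2^s for a positive integer s. If f(x) = a₂·x² − a₁·x − a₀ ∈ F_q[x] with a₂ ≠ 0 and a₁ ≠ 0, then the third iterate f³ = f ∘ f ∘ f is not irreducible over F_q. -/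
open Polynomial

/-- In characteristic 2, the fourth iterate of an endomorphism fixing `a`, `b`, `c` fixes the zeros
of the third iterate of the quadratic map `x ↦ a * x ^ 2 - b * x - c`. -/
theorem RingHom.iterate_four_eq_of_quadratic_iterate_eq_zero {E : Type*} [Field E] [CharP E 2]
    (φ : E →+* E) {a b c : E} (hφa : φ a = a) (hφb : φ b = b) (hφc : φ c = c) (ha : a ≠ 0)
    {x y z : E} (hy : y = a * x ^ 2 - b * x - c) (hz : z = a * y ^ 2 - b * y - c)
    (hz0 : 0 = a * z ^ 2 - b * z - c) :
    φ^[4] x = x := by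
  have h2 : (2 : E) = 0 := CharTwo.two_eq_zero
  -- The difference operator `φ - 1` turns the quadratic map into its linearized part.
  obtain ⟨D, hD⟩ : ∃ D : E → E, ∀ u, D u = φ u - u := ⟨_, fun _ ↦ rfl⟩
  have hD0 : D 0 = 0 := by simp [hD]
  have hstep {c u v : E} (hc : φ c = c) (h : u = a * v ^ 2 - b * v - c) :
      D u = a * D v ^ 2 - b * D v - 0 := by
    have hφu : φ u = a * φ v ^ 2 - b * φ v - c := by simp [h, hφa, hφb, hc]
    rw [hD, hD]
    linear_combination hφu - h + (a * φ v * v - a * v ^ 2) * h2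
  have hker {v : E} (h : 0 = a * v ^ 2 - b * v - 0) : D v = 0 := by
    have hv : v * (a * v - b) = 0 := by linear_combination -h
    rcases mul_eq_zero.1 hv with rfl | h
    · exact hD0
    · have hvb : v = b / a := by
        rw [eq_div_iff ha]
        linear_combination h
      rw [hD, hvb, map_div₀, hφa, hφb, sub_self]
  have hDz : D (D z) = 0 := hker (hD0.symm.trans (hstep hφc hz0))
  have hDy : D (D (D y)) = 0 :=
    hker (hDz.symm.trans (hstep (map_zero φ) (hstep hφc hz)))
  have hDx : D (D (D (D x))) = 0 :=
    hker (hDy.symm.trans (hstep (map_zero φ) (hstep (map_zero φ) (hstep hφc hy))))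
  simp only [hD, map_sub] at hDx
  change φ (φ (φ (φ x))) = x
  linear_combination hDx + (2 * φ (φ (φ x)) - 3 * φ (φ x) + 2 * φ x - x) * h2

theorem stmt12 {K : Type*} [Field K] [Fintype K] {s : ℕ}
    (hs : 0 < s) (hcard : Fintype.card K = 2 ^ s)
    (a₂ a₁ a₀ : K) (ha2 : a₂ ≠ 0) (ha1 : a₁ ≠ 0)
    (f : K[X]) (hf : f = C a₂ * X ^ 2 - C a₁ * X - C a₀) :
    ¬ Irreducible (polyIter f 3) := by
  have hiter : polyIter f 3 = f.comp (f.comp f) := by simp [polyIter]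
  rw [hiter]
  intro hirr
  have hchar : CharP K 2 := charP_of_card_eq_prime_pow hcard
  have hdeg : (f.comp (f.comp f)).natDegree = 8 := by
    have h : f.natDegree = 2 := by
      rw [hf]
      compute_degree!
    simp [natDegree_comp, h]
  have : Fact (Irreducible (f.comp (f.comp f))) := ⟨hirr⟩
  have hE : CharP (AdjoinRoot (f.comp (f.comp f))) 2 :=
    charP_of_injective_algebraMap (algebraMap K _).injective 2
  set α := AdjoinRoot.root (f.comp (f.comp f)) with hα
  have hroot : aeval α (f.comp (f.comp f)) = 0 := by
    simp [hα]
  have heval (β : AdjoinRoot (f.comp (f.comp f))) : aeval β f =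
      algebraMap K _ a₂ * β ^ 2 - algebraMap K _ a₁ * β - algebraMap K _ a₀ := by
    simp only [hf, map_sub, map_mul, map_pow, aeval_C, aeval_X]
  have hzero : aeval (aeval (aeval α f) f) f = 0 := by
    rwa [aeval_comp, aeval_comp] at hroot
  have hfix := RingHom.iterate_four_eq_of_quadratic_iterate_eq_zero
    (FiniteField.frobeniusAlgHom K (AdjoinRoot (f.comp (f.comp f)))).toRingHom
    (AlgHom.commutes _ a₂) (AlgHom.commutes _ a₁) (AlgHom.commutes _ a₀) (by simpa using ha2)
    (heval α) (heval _) (hzero.symm.trans (heval _))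
  have hdvd : f.comp (f.comp f) ∣ X ^ Nat.card K ^ 4 - X := by
    rw [← AdjoinRoot.mk_eq_zero, map_sub, map_pow, AdjoinRoot.mk_X, sub_eq_zero, ← hα,
      Nat.card_eq_fintype_card]
    change (· ^ Fintype.card K)^[4] α = α at hfix
    rwa [pow_iterate] at hfix
  have h := hirr.natDegree_dvd_of_dvd_X_pow_card_pow_sub_X hdvd
  rw [hdeg] at h
  omega
end

section
/- Each of the polynomials f(x) = x³ − 3x² + 3 and g(x) = x³ + 3x² − 3 over the finite field F_7 is dynamically irreducible: for every positive integer n, the n-fold compositions f^n and g^n are irreducible over F_7. -/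
open Polynomial

instance : Fact (Nat.Prime 7) := ⟨by norm_num⟩

open IntermediateField in
/-- If `z` generates an extension of odd degree and is quadratic over `K⟮x⟯`, then `x` is a
generator as well, so a monic polynomial of that degree with root `x` is irreducible. -/
lemma irreducible_of_root_of_quadratic {K L : Type*} [Field K] [Field L] [Algebra K L]
    [FiniteDimensional K L] (hodd : Odd (Module.finrank K L)) {z x : L} (hz : K⟮z⟯ = ⊤)
    {a b : K} (hzx : z ^ 2 + 1 = (algebraMap K L a * x + algebraMap K L b) * z)
    {P : K[X]} (hP : P.Monic) (hdeg : P.natDegree = Module.finrank K L)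
    (hroot : aeval x P = 0) : Irreducible P := by
  have hx : IsIntegral K x := .of_finite K x
  have htop : K⟮x⟯⟮z⟯ = ⊤ := adjoin_eq_top_of_adjoin_eq_top K hz
  have hle : Module.finrank K⟮x⟯ L ≤ 2 := by
    rw [← finrank_top', ← htop, adjoin.finrank (.of_finite K⟮x⟯ z)]
    let c : K⟮x⟯ := algebraMap K _ a * AdjoinSimple.gen K x + algebraMap K _ b
    have hmonic : (X ^ 2 - C c * X + C 1 : K⟮x⟯[X]).Monic := by monicity!
    have hnat : (X ^ 2 - C c * X + C 1 : K⟮x⟯[X]).natDegree = 2 := by compute_degree!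
    rw [← hnat]
    refine natDegree_le_of_dvd (minpoly.dvd _ _ ?_) hmonic.ne_zero
    have hc : algebraMap K⟮x⟯ L c = algebraMap K L a * x + algebraMap K L b := by
      simp [c]
    simp only [map_add, map_sub, map_mul, map_pow, aeval_X, aeval_C, map_one, hc]
    linear_combination hzx
  have hmul := Module.finrank_mul_finrank K K⟮x⟯ L
  have hone : Module.finrank K⟮x⟯ L = 1 := by
    have hpos : 0 < Module.finrank K⟮x⟯ L := Module.finrank_pos
    have := (Nat.odd_mul.mp (hmul ▸ hodd)).2
    grind
  rw [hone, mul_one, adjoin.finrank hx] at hmul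
  rw [eq_of_monic_of_dvd_of_natDegree_le (minpoly.monic hx) hP (minpoly.dvd K x hroot)
    (by rw [hdeg, hmul])]
  exact minpoly.irreducible hx

lemma monic_and_natDegree_polyIter {K : Type*} [Field K] {f : K[X]} (hf : f.Monic) (hd : f.natDegree ≠ 0)
    (n : ℕ) : (polyIter f n).Monic ∧ (polyIter f n).natDegree = f.natDegree ^ n := by
  induction n with
  | zero => exact ⟨monic_X, by simp [polyIter]⟩
  | succ n ih =>
    refine ⟨hf.comp ih.1 ?_, ?_⟩
    · rw [ih.2]
      exact pow_ne_zero n hd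
    · rw [polyIter, natDegree_comp, ih.2, pow_succ']

/-- A monic cubic over `ZMod 7` that `w ↦ ε * (1 + w + w⁻¹)` semiconjugates to `w ↦ w ^ 3` has
irreducible iterates. -/
lemma irreducible_polyIter_of_semiconj {f : (ZMod 7)[X]} (hf : f.Monic) (hd : f.natDegree = 3)
    {ε : ZMod 7} (hε : ε * ε = 1)
    (hcomp : ∀ (L : Type) [Field L] [Algebra (ZMod 7) L] (w : L), w ≠ 0 →
      aeval (algebraMap (ZMod 7) L ε * (1 + w + w⁻¹)) f =
        algebraMap (ZMod 7) L ε * (1 + w ^ 3 + (w ^ 3)⁻¹)) (n : ℕ) :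
    Irreducible (polyIter f n) := by
  have hirr : Irreducible (X ^ 3 ^ n - C 2 : (ZMod 7)[X]) :=
    X_pow_sub_C_irreducible_of_prime_pow Nat.prime_three (by norm_num) n (by decide)
  have : Fact (Irreducible (X ^ 3 ^ n - C 2 : (ZMod 7)[X])) := ⟨hirr⟩
  let L := AdjoinRoot (X ^ 3 ^ n - C 2 : (ZMod 7)[X])
  let z : L := AdjoinRoot.root _
  let pb := AdjoinRoot.powerBasis hirr.ne_zero
  have : FiniteDimensional (ZMod 7) L := pb.finite
  have hrank : Module.finrank (ZMod 7) L = 3 ^ n := by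
    rw [pb.finrank, AdjoinRoot.powerBasis_dim, natDegree_X_pow_sub_C]
  have hz : z ^ 3 ^ n = algebraMap (ZMod 7) L 2 := by
    have := AdjoinRoot.aeval_eq (f := (X ^ 3 ^ n - C 2 : (ZMod 7)[X])) (X ^ 3 ^ n - C 2)
    rw [AdjoinRoot.mk_self, map_sub, map_pow, aeval_X, aeval_C] at this
    exact sub_eq_zero.mp this
  have h2 : algebraMap (ZMod 7) L 2 ≠ 0 := by
    rw [Ne, map_eq_zero]
    decide
  have hz0 : z ≠ 0 := by
    intro h
    rw [h, zero_pow (by positivity)] at hz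
    exact h2 hz.symm
  have hiter (m : ℕ) : aeval (algebraMap (ZMod 7) L ε * (1 + z + z⁻¹)) (polyIter f m) =
      algebraMap (ZMod 7) L ε * (1 + z ^ 3 ^ m + (z ^ 3 ^ m)⁻¹) := by
    induction m with
    | zero => simp [polyIter]
    | succ m ih =>
      rw [polyIter, aeval_comp, ih, hcomp L _ (pow_ne_zero _ hz0), ← pow_mul, ← pow_succ]
  have hmon := monic_and_natDegree_polyIter hf (by simp [hd]) n
  refine irreducible_of_root_of_quadratic (z := z) (a := ε) (b := -1)
    (x := algebraMap (ZMod 7) L ε * (1 + z + z⁻¹)) ?_ ?_ ?_ hmon.1 ?_ ?_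
  · rw [hrank]
    exact Odd.pow (by decide)
  · exact IntermediateField.adjoin_root_eq_top _
  · rw [← mul_assoc, ← map_mul, hε, map_one, map_neg, map_one]
    linear_combination -mul_inv_cancel₀ hz0
  · rw [hmon.2, hd, hrank]
  · have hinv : (algebraMap (ZMod 7) L 2)⁻¹ = algebraMap (ZMod 7) L 4 := by
      rw [← map_inv₀, inv_eq_of_mul_eq_one_right (by decide : (2 * 4 : ZMod 7) = 1)]
    rw [hiter, hz, hinv, ← map_one (algebraMap (ZMod 7) L), ← map_add, ← map_add, ← map_mul,
      show (1 + 2 + 4 : ZMod 7) = 0 by decide, mul_zero, map_zero]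

theorem stmt15 :
    (∀ n : ℕ, 0 < n →
      Irreducible (polyIter ((X : (ZMod 7)[X]) ^ 3 - C 3 * X ^ 2 + C 3) n)) ∧
    (∀ n : ℕ, 0 < n →
      Irreducible (polyIter ((X : (ZMod 7)[X]) ^ 3 + C 3 * X ^ 2 - C 3) n)) := by
  refine ⟨fun n _ ↦ irreducible_polyIter_of_semiconj (ε := 1) (by monicity!)
      (by compute_degree!) (by decide) ?_ n,
    fun n _ ↦ irreducible_polyIter_of_semiconj (ε := -1) (by monicity!)
      (by compute_degree!) (by decide) ?_ n⟩
  all_goals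
    intro L _ _ w hw
    simp only [map_add, map_sub, map_mul, map_pow, map_neg, map_one, aeval_X, map_ofNat]
    field_simp
    ring
end

section
/- Let h(x) = x³ + 6x + 2 over the finite field F_7. Then the iterates h, h², h³, and h⁴ are all irreducible over F_7, while the fifth iterate h⁵ is not irreducible over F_7. -/
open Polynomial

/-! ### Arithmetic of coefficient lists modulo `7` -/

/-- Coefficientwise sum modulo `7`. -/
def addDigits : List ℕ → List ℕ → List ℕ
  | [], m => m
  | a :: l, [] => a :: l
  | a :: l, b :: m => (a + b) % 7 :: addDigits l m

/-- Scalar multiple modulo `7`. -/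
def smulDigits (c : ℕ) : List ℕ → List ℕ
  | [] => []
  | a :: l => c * a % 7 :: smulDigits c l

/-- Product of coefficient lists modulo `7`. -/
def mulDigits : List ℕ → List ℕ → List ℕ
  | [], _ => []
  | a :: l, m => addDigits (smulDigits a m) (0 :: mulDigits l m)

/-- Coefficients of `p ^ 3 + 6 * p + 2` in terms of those of `p`. -/
def cubicDigits (l : List ℕ) : List ℕ :=
  addDigits (mulDigits l (mulDigits l l)) (addDigits (smulDigits 6 l) [2])

section Digits

variable {R : Type*} [CommRing R] [CharP R 7] (x : R)

theorem ofDigits_addDigits (l m : List ℕ) :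
    Nat.ofDigits x (addDigits l m) = Nat.ofDigits x l + Nat.ofDigits x m := by
  induction l generalizing m with
  | nil => simp [addDigits, Nat.ofDigits]
  | cons a l ih =>
    cases m with
    | nil => simp [addDigits, Nat.ofDigits]
    | cons b m =>
      simp only [addDigits, Nat.ofDigits] at ih ⊢
      rw [ih, ← CharP.cast_eq_mod R 7]
      push_cast
      ring

theorem ofDigits_smulDigits (c : ℕ) (l : List ℕ) :
    Nat.ofDigits x (smulDigits c l) = c * Nat.ofDigits x l := by
  induction l with
  | nil => simp [smulDigits, Nat.ofDigits]
  | cons a l ih =>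
    simp only [smulDigits, Nat.ofDigits] at ih ⊢
    rw [ih, ← CharP.cast_eq_mod R 7]
    push_cast
    ring

theorem ofDigits_mulDigits (l m : List ℕ) :
    Nat.ofDigits x (mulDigits l m) = Nat.ofDigits x l * Nat.ofDigits x m := by
  induction l with
  | nil => simp [mulDigits, Nat.ofDigits]
  | cons a l ih =>
    rw [mulDigits, ofDigits_addDigits, ofDigits_smulDigits]
    simp only [Nat.ofDigits] at ih ⊢
    rw [ih]
    push_cast
    ring

theorem ofDigits_cubicDigits (l : List ℕ) :
    Nat.ofDigits x (cubicDigits l) = Nat.ofDigits x l ^ 3 + 6 * Nat.ofDigits x l + 2 := by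
  rw [cubicDigits, ofDigits_addDigits, ofDigits_addDigits, ofDigits_mulDigits, ofDigits_mulDigits,
    ofDigits_smulDigits]
  simp only [Nat.ofDigits]
  push_cast
  ring

end Digits

theorem coeff_ofDigits_X {R : Type*} [CommSemiring R] (l : List ℕ) (n : ℕ) :
    (Nat.ofDigits (X : R[X]) l).coeff n = (l.getD n 0 : ℕ) := by
  induction l generalizing n with
  | nil => simp [Nat.ofDigits]
  | cons a l ih =>
    simp only [Nat.ofDigits] at ih ⊢
    cases n with
    | zero => simp
    | succ n => simp [ih, coeff_natCast_ite]

/-! ### Irreducibility of the composition with the cubic -/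

/-- The resolvent step of Cardano's formula: if `γ ^ 3 - 3 * a * γ = u + a ^ 3 / u`, then `u` is a
cube. -/
theorem exists_pow_three_eq_of_resolvent {K : Type*} [Field K] {a γ u : K}
    (h : u ^ 2 - (γ ^ 3 - 3 * a * γ) * u + a ^ 3 = 0) : ∃ t, t ^ 3 = u := by
  by_cases ha : γ ^ 2 = a
  · subst ha
    have : (u + γ ^ 3) ^ 2 = 0 := by linear_combination h
    exact ⟨-γ, by linear_combination -(pow_eq_zero_iff two_ne_zero).mp this⟩
  · refine ⟨(u + a * γ) / (γ ^ 2 - a), ?_⟩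
    have ha' : γ ^ 2 - a ≠ 0 := sub_ne_zero.mpr ha
    rw [div_pow, div_eq_iff (pow_ne_zero 3 ha')]
    linear_combination (u + γ ^ 3) * h

theorem PowerBasis.norm_algebraMap_sub_gen {R S : Type*} [CommRing R] [CommRing S] [Algebra R S]
    (pb : PowerBasis R S) (c : R) :
    Algebra.norm R (algebraMap R S c - pb.gen) = (minpoly R pb.gen).eval c := by
  rw [Algebra.norm_eq_matrix_det pb.basis, ← charpoly_leftMulMatrix, Matrix.eval_charpoly, map_sub,
    AlgHom.commutes]
  rfl

/-- Here `u` is a root of the resolvent quadratic of the cubic over the field defined by `P`, and it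
differs by a cube from `X - 3`, whose norm is not a cube. -/
theorem cubic_ne_gen_of_resolvent {E : Type*} [Field E] [Algebra (ZMod 7) E]
    (pb : PowerBasis (ZMod 7) E) {P w u q₁ q₂ : (ZMod 7)[X]} (hP : minpoly (ZMod 7) pb.gen = P)
    (hc : P.eval 3 = 3 ∨ P.eval 3 = 5) (h₁ : w ^ 3 * (X + 4) = u + P * q₁)
    (h₂ : u ^ 2 + (6 * X + 2) * u + 6 = P * q₂) (γ : E) : γ ^ 3 + 6 * γ + 2 ≠ pb.gen := by
  intro hγ
  have hPβ : aeval pb.gen P = 0 := hP ▸ minpoly.aeval _ _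
  have hN := PowerBasis.norm_algebraMap_sub_gen pb 3
  have e₁ := congrArg (aeval pb.gen) h₁
  have e₂ := congrArg (aeval pb.gen) h₂
  simp only [map_mul, map_add, map_pow, map_ofNat, aeval_X, hPβ, zero_mul, add_zero] at e₁ e₂ hN
  rw [hP] at hN
  generalize aeval pb.gen w = W at e₁
  generalize aeval pb.gen u = U at e₁ e₂
  generalize pb.gen = β at *
  have h7 : (7 : E) = 0 := by
    have : (7 : ZMod 7) = 0 := rfl
    simpa only [map_ofNat, map_zero] using congrArg (algebraMap (ZMod 7) E) this
  obtain ⟨t, ht⟩ : ∃ t, t ^ 3 = U := by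
    refine exists_pow_three_eq_of_resolvent (a := 5) (γ := γ) ?_
    linear_combination e₂ + 6 * U * hγ + (17 + (-γ ^ 3 - 3 * γ - 2) * U) * h7
  have hW : W ≠ 0 := by
    rintro rfl
    rw [zero_pow three_ne_zero, zero_mul] at e₁
    rw [← e₁] at e₂
    exact one_ne_zero (α := E) (by linear_combination h7 - e₂)
  have hs : (-(t / W)) ^ 3 = 3 - β := by
    have : t ^ 3 / W ^ 3 = β + 4 := by
      rw [ht, ← e₁, mul_div_cancel_left₀ _ (pow_ne_zero 3 hW)]
    linear_combination -this - h7
  rw [← hs, map_pow] at hN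
  rw [← hN] at hc
  revert hc
  generalize Algebra.norm (ZMod 7) (-(t / W)) = N
  revert N
  decide

theorem irreducible_comp_of_resolvent {P w u q₁ q₂ : (ZMod 7)[X]} (hP : P.Monic)
    (hirr : Irreducible P) (hc : P.eval 3 = 3 ∨ P.eval 3 = 5)
    (h₁ : w ^ 3 * (X + 4) = u + P * q₁) (h₂ : u ^ 2 + (6 * X + 2) * u + 6 = P * q₂) :
    Irreducible (P.comp (X ^ 3 + C 6 * X + C 2)) := by
  have hdeg : (X ^ 3 + C 6 * X + C 2 : (ZMod 7)[X]).natDegree = 3 := by compute_degree!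
  have hmon : (X ^ 3 + C 6 * X + C 2 : (ZMod 7)[X]).Monic := by monicity!
  refine irreducible_comp hP hmon hirr fun E _ _ x hx => ?_
  have hint : IsIntegral (ZMod 7) x := by
    by_contra hx'
    exact hirr.ne_zero (hx ▸ minpoly.eq_zero hx')
  apply irreducible_of_degree_le_three_of_not_isRoot
  · rw [natDegree_sub_C, hmon.natDegree_map, hdeg]
    simp
  intro γ hγ
  refine cubic_ne_gen_of_resolvent (IntermediateField.adjoin.powerBasis hint) (P := P) ?_
    hc h₁ h₂ γ ?_
  · rw [IntermediateField.adjoin.powerBasis_gen, IntermediateField.minpoly_gen, hx]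
  · rw [IntermediateField.adjoin.powerBasis_gen, ← sub_eq_zero]
    have h6 : algebraMap (ZMod 7) (IntermediateField.adjoin (ZMod 7) {x}) 6 = 6 := map_ofNat _ 6
    have h2 : algebraMap (ZMod 7) (IntermediateField.adjoin (ZMod 7) {x}) 2 = 2 := map_ofNat _ 2
    simpa [h6, h2] using hγ

theorem monic_polyIter {K : Type*} [Field K] {f : K[X]} (hf : f.Monic) (hd : f.natDegree ≠ 0)
    (n : ℕ) : (polyIter f n).Monic := by
  induction n with
  | zero => exact monic_X
  | succ n ih => rw [polyIter_succ_eq_comp]; exact ih.comp hf hd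

theorem eval_three_polyIter (n : ℕ) :
    (polyIter (X ^ 3 + C 6 * X + C 2 : (ZMod 7)[X]) n).eval 3 = 3 ∨
      (polyIter (X ^ 3 + C 6 * X + C 2 : (ZMod 7)[X]) n).eval 3 = 5 := by
  induction n with
  | zero => simp [polyIter]
  | succ n ih =>
    simp only [polyIter, eval_comp, eval_add, eval_mul, eval_pow, eval_X, eval_C]
    rcases ih with h | h <;> rw [h] <;> decide

theorem polyIter_succ_eq_ofDigits {n : ℕ} {l m : List ℕ}
    (h : polyIter (X ^ 3 + C 6 * X + C 2 : (ZMod 7)[X]) n = Nat.ofDigits X l)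
    (hm : cubicDigits l = m) :
    polyIter (X ^ 3 + C 6 * X + C 2 : (ZMod 7)[X]) (n + 1) = Nat.ofDigits X m := by
  rw [← hm, ofDigits_cubicDigits, ← h, polyIter]
  have h6 : (C 6 : (ZMod 7)[X]) = 6 := map_ofNat C 6
  have h2 : (C 2 : (ZMod 7)[X]) = 2 := map_ofNat C 2
  simp [h6, h2]

theorem irreducible_polyIter_succ_of_digits {n : ℕ} {l w u q₁ q₂ : List ℕ}
    (hl : polyIter (X ^ 3 + C 6 * X + C 2 : (ZMod 7)[X]) n = Nat.ofDigits X l)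
    (hirr : Irreducible (polyIter (X ^ 3 + C 6 * X + C 2 : (ZMod 7)[X]) n))
    (h₁ : mulDigits (mulDigits w (mulDigits w w)) [4, 1] = addDigits u (mulDigits l q₁))
    (h₂ : addDigits (mulDigits u u) (addDigits (mulDigits [2, 6] u) [6]) = mulDigits l q₂) :
    Irreducible (polyIter (X ^ 3 + C 6 * X + C 2 : (ZMod 7)[X]) (n + 1)) := by
  have hmon : (polyIter (X ^ 3 + C 6 * X + C 2 : (ZMod 7)[X]) n).Monic := by
    refine monic_polyIter (by monicity!) ?_ n
    have : (X ^ 3 + C 6 * X + C 2 : (ZMod 7)[X]).natDegree = 3 := by compute_degree!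
    simp [this]
  have e₁ := congrArg (Nat.ofDigits (X : (ZMod 7)[X])) h₁
  have e₂ := congrArg (Nat.ofDigits (X : (ZMod 7)[X])) h₂
  simp only [ofDigits_addDigits, ofDigits_mulDigits, ← hl] at e₁ e₂
  simp only [Nat.ofDigits] at e₁ e₂
  rw [polyIter_succ_eq_comp]
  refine irreducible_comp_of_resolvent (w := Nat.ofDigits X w) (u := Nat.ofDigits X u)
    (q₁ := Nat.ofDigits X q₁) (q₂ := Nat.ofDigits X q₂) hmon hirr (eval_three_polyIter n) ?_ ?_
  · push_cast at e₁
    linear_combination e₁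
  · push_cast at e₂
    linear_combination e₂

/-- The base `7` coefficient list of the iterate of order 1. -/
def iterDigits1 : List ℕ :=
  [2, 6, 0, 1]

/-- The base `7` coefficient list of the iterate of order 2. -/
def iterDigits2 : List ℕ :=
  [1, 3, 6, 3, 2, 3, 6, 4, 0, 1]

/-- The base `7` coefficient list of the iterate of order 3. -/
def iterDigits3 : List ℕ :=
  [2, 6, 4, 1, 6, 2, 3, 3, 3, 5, 2, 3, 6, 2, 6, 5, 6, 0, 6, 0, 0, 1, 3, 1, 4, 5, 0, 1]

/-- The base `7` coefficient list of the iterate of order 4. -/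
def iterDigits4 : List ℕ :=
  [1, 3, 1, 4, 1, 2, 4, 2, 4, 2, 3, 2, 6, 6, 1, 2, 2, 5, 2, 6, 2, 6, 5, 3, 4, 3, 3, 1, 0, 2, 2, 4,
  6, 6, 2, 3, 1, 1, 6, 0, 2, 6, 3, 4, 5, 5, 3, 1, 2, 4, 6, 2, 4, 3, 2, 4, 3, 5, 6, 0, 3, 5, 5, 2,
  5, 4, 0, 6, 5, 0, 1, 6, 0, 0, 1, 3, 3, 1, 5, 1, 0, 1]

/-- Coefficients of a factor of degree `81` of the fifth iterate. -/
def factorDigits : List ℕ :=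
  [4, 6, 0, 3, 5, 5, 4, 4, 6, 5, 0, 4, 2, 6, 0, 4, 3, 5, 2, 2, 2, 5, 5, 2, 1, 6, 0, 3, 1, 1, 5, 0,
  0, 0, 0, 0, 4, 1, 4, 3, 2, 3, 5, 5, 5, 0, 6, 6, 0, 0, 0, 5, 3, 6, 3, 1, 3, 3, 6, 1, 3, 4, 3, 6,
  4, 5, 5, 6, 3, 4, 6, 2, 6, 1, 4, 4, 3, 3, 3, 2, 3, 1]

/-- Coefficients of the cofactor of `factorDigits`, of degree `162`. -/
def cofactorDigits : List ℕ :=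
  [4, 6, 0, 5, 2, 6, 6, 4, 4, 3, 0, 0, 0, 1, 1, 6, 0, 6, 5, 2, 2, 6, 4, 5, 2, 1, 2, 3, 0, 6, 2, 0,
  4, 6, 0, 2, 0, 6, 5, 5, 0, 0, 1, 5, 5, 5, 0, 1, 5, 0, 3, 4, 6, 6, 1, 6, 6, 6, 0, 3, 5, 2, 0, 0,
  3, 2, 0, 4, 2, 0, 3, 4, 2, 4, 4, 5, 5, 1, 4, 0, 2, 4, 4, 2, 3, 5, 5, 0, 1, 4, 5, 4, 1, 0, 3, 3,
  3, 2, 1, 2, 4, 4, 0, 5, 0, 4, 0, 1, 6, 4, 2, 2, 5, 2, 1, 0, 3, 1, 2, 4, 4, 6, 1, 5, 1, 6, 2, 5,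
  5, 2, 1, 1, 6, 2, 3, 6, 1, 2, 3, 4, 3, 4, 5, 5, 6, 0, 5, 6, 3, 4, 0, 0, 5, 3, 3, 5, 6, 4, 0, 2,
  3, 4, 1]

theorem polyIter_eq_ofDigits_0 :
    polyIter (X ^ 3 + C 6 * X + C 2 : (ZMod 7)[X]) 0 = Nat.ofDigits X [0, 1] := by
  simp [polyIter, Nat.ofDigits]

theorem polyIter_eq_ofDigits_1 :
    polyIter (X ^ 3 + C 6 * X + C 2 : (ZMod 7)[X]) 1 = Nat.ofDigits X iterDigits1 :=
  polyIter_succ_eq_ofDigits polyIter_eq_ofDigits_0 (by decide +kernel)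

theorem polyIter_eq_ofDigits_2 :
    polyIter (X ^ 3 + C 6 * X + C 2 : (ZMod 7)[X]) 2 = Nat.ofDigits X iterDigits2 :=
  polyIter_succ_eq_ofDigits polyIter_eq_ofDigits_1 (by decide +kernel)

theorem polyIter_eq_ofDigits_3 :
    polyIter (X ^ 3 + C 6 * X + C 2 : (ZMod 7)[X]) 3 = Nat.ofDigits X iterDigits3 :=
  polyIter_succ_eq_ofDigits polyIter_eq_ofDigits_2 (by decide +kernel)

theorem polyIter_eq_ofDigits_4 :
    polyIter (X ^ 3 + C 6 * X + C 2 : (ZMod 7)[X]) 4 = Nat.ofDigits X iterDigits4 :=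
  polyIter_succ_eq_ofDigits polyIter_eq_ofDigits_3 (by decide +kernel)

theorem irreducible_polyIter_1 : Irreducible (polyIter (X ^ 3 + C 6 * X + C 2 : (ZMod 7)[X]) 1) := by
  refine irreducible_polyIter_succ_of_digits polyIter_eq_ofDigits_0 (by simpa [polyIter] using irreducible_X)
    (w := [6])
    (u := [3])
    (q₁ := [6])
    (q₂ := [4])
    (by decide +kernel) (by decide +kernel)

theorem irreducible_polyIter_2 : Irreducible (polyIter (X ^ 3 + C 6 * X + C 2 : (ZMod 7)[X]) 2) := by
  refine irreducible_polyIter_succ_of_digits polyIter_eq_ofDigits_1 (irreducible_polyIter_1)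
    (w := [3, 4, 4])
    (u := [3, 4, 5])
    (q₁ := [0, 0, 6, 0, 1])
    (q₂ := [0, 4])
    (by decide +kernel) (by decide +kernel)

theorem irreducible_polyIter_3 : Irreducible (polyIter (X ^ 3 + C 6 * X + C 2 : (ZMod 7)[X]) 3) := by
  refine irreducible_polyIter_succ_of_digits polyIter_eq_ofDigits_2 (irreducible_polyIter_2)
    (w := [4, 3, 3, 5, 3, 5, 2, 2, 3])
    (u := [6, 2, 5, 6, 6, 0, 2, 3, 3])
    (q₁ := [5, 0, 4, 2, 3, 6, 1, 3, 3, 6, 1, 2, 1, 3, 2, 1, 6])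
    (q₂ := [5, 0, 0, 0, 5, 6, 4, 2])
    (by decide +kernel) (by decide +kernel)

theorem irreducible_polyIter_4 : Irreducible (polyIter (X ^ 3 + C 6 * X + C 2 : (ZMod 7)[X]) 4) := by
  refine irreducible_polyIter_succ_of_digits polyIter_eq_ofDigits_3 (irreducible_polyIter_3)
    (w := [5, 1, 0, 4, 2, 0, 6, 1, 4, 4, 2, 4, 0, 2, 0, 1, 5, 3, 1, 1, 3, 2, 0, 0, 3, 5, 6])
    (u := [0, 2, 3, 3, 6, 6, 2, 5, 1, 3, 1, 1, 5, 0, 1, 2, 3, 3, 6, 6, 5, 4, 5, 6, 1, 2, 1])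
    (q₁ := [5, 4, 2, 0, 5, 5, 2, 1, 1, 6, 1, 2, 0, 0, 5, 1, 6, 2, 2, 1, 1, 1, 0, 3, 6, 5, 0, 0, 0,
    2, 5, 3, 4, 2, 2, 4, 6, 3, 2, 1, 4, 5, 0, 3, 0, 0, 3, 5, 6, 0, 6, 4, 6])
    (q₂ := [3, 0, 5, 5, 2, 6, 0, 3, 5, 5, 0, 2, 2, 1, 5, 0, 2, 1, 5, 4, 6, 6, 6, 1, 4, 1])
    (by decide +kernel) (by decide +kernel)

theorem not_isUnit_ofDigits_X {l : List ℕ} (h : ((l.getD 1 0 : ℕ) : ZMod 7) ≠ 0) :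
    ¬ IsUnit (Nat.ofDigits (X : (ZMod 7)[X]) l) := by
  intro hu
  obtain ⟨r, -, hr⟩ := Polynomial.isUnit_iff.mp hu
  rw [← coeff_ofDigits_X, ← hr, coeff_C_succ] at h
  exact h rfl

theorem not_irreducible_ofDigits_mulDigits {l m : List ℕ}
    (hl : ((l.getD 1 0 : ℕ) : ZMod 7) ≠ 0) (hm : ((m.getD 1 0 : ℕ) : ZMod 7) ≠ 0) :
    ¬ Irreducible (Nat.ofDigits (X : (ZMod 7)[X]) (mulDigits l m)) := by
  rw [ofDigits_mulDigits]
  intro h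
  rcases h.isUnit_or_isUnit rfl with h | h
  · exact not_isUnit_ofDigits_X hl h
  · exact not_isUnit_ofDigits_X hm h

theorem not_irreducible_polyIter_5 :
    ¬ Irreducible (polyIter (X ^ 3 + C 6 * X + C 2 : (ZMod 7)[X]) 5) := by
  rw [polyIter_succ_eq_ofDigits polyIter_eq_ofDigits_4
    (m := mulDigits factorDigits cofactorDigits) (by decide +kernel)]
  exact not_irreducible_ofDigits_mulDigits (by decide) (by decide)

theorem stmt16 :
    Irreducible (polyIter ((X : (ZMod 7)[X]) ^ 3 + C 6 * X + C 2) 1) ∧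
    Irreducible (polyIter ((X : (ZMod 7)[X]) ^ 3 + C 6 * X + C 2) 2) ∧
    Irreducible (polyIter ((X : (ZMod 7)[X]) ^ 3 + C 6 * X + C 2) 3) ∧
    Irreducible (polyIter ((X : (ZMod 7)[X]) ^ 3 + C 6 * X + C 2) 4) ∧
    ¬ Irreducible (polyIter ((X : (ZMod 7)[X]) ^ 3 + C 6 * X + C 2) 5) :=
  ⟨irreducible_polyIter_1, irreducible_polyIter_2, irreducible_polyIter_3,
    irreducible_polyIter_4, not_irreducible_polyIter_5⟩
end

section
/- Let h(x) = x³ + x + 1 over the finite field F_19. Then h and h² are irreducible over F_19, while the third iterate h³ is not irreducible over F_19. -/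
open Polynomial

instance : Fact (Nat.Prime 19) := ⟨by norm_num⟩

open IntermediateField

theorem natDegree_X_pow_three_add_X_add_C {R : Type*} [CommRing R] [Nontrivial R] (c : R) :
    (X ^ 3 + X + C c : R[X]).natDegree = 3 := by
  compute_degree!

theorem monic_X_pow_three_add_X_add_C {R : Type*} [CommRing R] [Nontrivial R] (c : R) :
    (X ^ 3 + X + C c : R[X]).Monic := by
  monicity!

theorem irreducible_X_pow_three_add_X_add_C {K : Type*} [Field K] {c : K}
    (h : ∀ y : K, y ^ 3 + y + c ≠ 0) : Irreducible (X ^ 3 + X + C c : K[X]) := by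
  apply irreducible_of_degree_le_three_of_not_isRoot
  · rw [natDegree_X_pow_three_add_X_add_C]
    simp
  · intro y hy
    exact h y (by simpa using hy)

theorem irreducible_X_pow_three_add_X_add_one :
    Irreducible (X ^ 3 + X + C 1 : (ZMod 19)[X]) :=
  irreducible_X_pow_three_add_X_add_C (by decide)

/-- The second and third equations of `coordinates_ne_zero`, with `a` eliminated through
`3 * D * a = c * (2 * D - 1)`, where `D = b ^ 3 + b * c ^ 2 + c ^ 3`. -/
theorem eq_zero_of_eliminants_eq_zero : ∀ b c : ZMod 19,
    let D := b ^ 3 + b * c ^ 2 + c ^ 3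
    let E := c * (2 * D - 1)
    b * E ^ 2 - 3 * D * E * c * (2 * b + c)
        + 3 * D ^ 2 * (2 * c ^ 3 - b ^ 3 - 3 * b ^ 2 * c + 3 * b * c ^ 2 + b - 1) = 0 →
      E ^ 3 + 9 * D ^ 2 * E * (1 - 6 * b * c)
        + 27 * D ^ 3 * (c ^ 3 - b ^ 3 + 3 * b * c ^ 2 + 1) = 0 →
      b = 0 ∧ c = 0 := by
  decide +kernel

/-- The coordinates of `y ^ 3 + y + 1 - x` in the basis `1, x, x ^ 2`, where `x ^ 3 + x + 1 = 0`
and `y = a + b * x + c * x ^ 2`, do not vanish simultaneously over `ZMod 19`. -/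
theorem coordinates_ne_zero (a b c : ZMod 19) :
    ¬ (3 * a ^ 2 * c + 3 * a * b ^ 2 - 3 * b ^ 2 * c - 3 * a * c ^ 2 - 3 * b * c ^ 2
          + c ^ 3 + c = 0 ∧
      3 * a ^ 2 * b - b ^ 3 - 6 * a * b * c - 3 * b ^ 2 * c - 3 * a * c ^ 2 + 3 * b * c ^ 2
          + 2 * c ^ 3 + b - 1 = 0 ∧
      a ^ 3 - b ^ 3 - 6 * a * b * c + 3 * b * c ^ 2 + c ^ 3 + a + 1 = 0) := by
  rintro ⟨h₁, h₂, h₃⟩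
  set D := b ^ 3 + b * c ^ 2 + c ^ 3 with hD
  have hE : c * (2 * D - 1) = 3 * D * a := by
    rw [hD]
    linear_combination c * h₂ - b * h₁
  obtain ⟨rfl, rfl⟩ : b = 0 ∧ c = 0 := by
    apply eq_zero_of_eliminants_eq_zero <;> rw [← hD, hE]
    · linear_combination 3 * D ^ 2 * h₂
    · linear_combination 27 * D ^ 3 * h₃
  simp at h₂

theorem coeffs_eq_zero_of_natDegree_minpoly_eq_three {K L : Type*} [Field K] [Field L]
    [Algebra K L] {x : L} (hx : (minpoly K x).natDegree = 3) {a b c : K}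
    (h : algebraMap K L a * x ^ 2 + algebraMap K L b * x + algebraMap K L c = 0) :
    a = 0 ∧ b = 0 ∧ c = 0 := by
  have hp : (C a * X ^ 2 + C b * X + C c : K[X]) = 0 := by
    by_contra hne
    have hle := natDegree_le_natDegree
      (minpoly.degree_le_of_ne_zero K x hne (by simpa using h))
    have : (C a * X ^ 2 + C b * X + C c).natDegree ≤ 2 := natDegree_quadratic_le
    omega
  refine ⟨?_, ?_, ?_⟩
  · simpa using congrArg (coeff · 2) hp
  · simpa using congrArg (coeff · 1) hp
  · simpa using congrArg (coeff · 0) hp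

theorem pow_three_add_self_add_one_ne_gen {L : Type*} [Field L] [Algebra (ZMod 19) L]
    (pb : PowerBasis (ZMod 19) L) (hpb : minpoly (ZMod 19) pb.gen = X ^ 3 + X + C 1) (y : L) :
    y ^ 3 + y + 1 - pb.gen ≠ 0 := by
  have hdeg : (minpoly (ZMod 19) pb.gen).natDegree = 3 := by
    rw [hpb, natDegree_X_pow_three_add_X_add_C]
  have hgen : pb.gen ^ 3 + pb.gen + 1 = 0 := by
    simpa [hpb] using minpoly.aeval (ZMod 19) pb.gen
  obtain ⟨f, hf, rfl⟩ := pb.exists_eq_aeval y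
  rw [← pb.natDegree_minpoly, hdeg] at hf
  intro h
  rw [f.as_sum_range' 3 hf] at h
  generalize f.coeff = u at h
  simp [Finset.sum_range_succ, aeval_monomial] at h
  apply coordinates_ne_zero (u 0) (u 1) (u 2)
  apply coeffs_eq_zero_of_natDegree_minpoly_eq_three hdeg
  simp only [map_add, map_sub, map_mul, map_pow, map_ofNat, map_one]
  generalize algebraMap (ZMod 19) L (u 0) = a at *
  generalize algebraMap (ZMod 19) L (u 1) = b at *
  generalize algebraMap (ZMod 19) L (u 2) = c at *
  generalize pb.gen = x at *
  linear_combination h - (b ^ 3 + 6 * a * b * c + (3 * b ^ 2 * c + 3 * a * c ^ 2) * x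
    + 3 * b * c ^ 2 * (x ^ 2 - 1) + c ^ 3 * (x ^ 3 - x - 1)) * hgen

theorem irreducible_X_pow_three_add_X_add_one_comp_self :
    Irreducible ((X ^ 3 + X + C 1 : (ZMod 19)[X]).comp (X ^ 3 + X + C 1)) := by
  refine irreducible_comp (monic_X_pow_three_add_X_add_C 1) (monic_X_pow_three_add_X_add_C 1)
    irreducible_X_pow_three_add_X_add_one fun E _ _ x hx ↦ ?_
  have hint : IsIntegral (ZMod 19) x := by
    by_contra hn
    rw [minpoly.eq_zero hn] at hx
    exact (monic_X_pow_three_add_X_add_C (1 : ZMod 19)).ne_zero hx.symm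
  have hgen := pow_three_add_self_add_one_ne_gen (adjoin.powerBasis hint)
    (by rw [adjoin.powerBasis_gen, minpoly_gen, hx])
  convert irreducible_X_pow_three_add_X_add_C (c := 1 - AdjoinSimple.gen (ZMod 19) x) ?_ using 1
  · simp [add_sub_assoc]
  · intro y hy
    exact hgen y (by rw [adjoin.powerBasis_gen, ← hy]; ring)

theorem polyIter_three_eq_mul :
    polyIter ((X : (ZMod 19)[X]) ^ 3 + X + C 1) 3 =
      (X ^ 9 + 3 * X ^ 8 + 2 * X ^ 7 - X ^ 6 - 3 * X ^ 5 - 6 * X ^ 4 - X ^ 3 - X ^ 2 - 7 * X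
        + 2) *
      (X ^ 18 - 3 * X ^ 17 - 3 * X ^ 16 + 6 * X ^ 15 + 5 * X ^ 14 + X ^ 13 - 5 * X ^ 12
        + 2 * X ^ 11 + 8 * X ^ 9 - 2 * X ^ 8 + 6 * X ^ 7 - 7 * X ^ 6 + 2 * X ^ 5 + 2 * X ^ 4
        - 6 * X ^ 3 - 3 * X ^ 2 + X + 6) := by
  have h19 : (19 : (ZMod 19)[X]) = 0 := CharP.cast_eq_zero _ 19
  simp only [polyIter, add_comp, pow_comp, X_comp, C_1, one_comp]
  linear_combination (1 + 8 * X + 13 * X ^ 2 + 22 * X ^ 3 + 39 * X ^ 4 + 61 * X ^ 5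
    + 81 * X ^ 6 + 100 * X ^ 7 + 129 * X ^ 8 + 140 * X ^ 9 + 154 * X ^ 10 + 156 * X ^ 11
    + 144 * X ^ 12 + 130 * X ^ 13 + 113 * X ^ 14 + 89 * X ^ 15 + 68 * X ^ 16 + 48 * X ^ 17
    + 32 * X ^ 18 + 24 * X ^ 19 + 14 * X ^ 20 + 5 * X ^ 21 + 2 * X ^ 22 + X ^ 23 + X ^ 24
    + X ^ 25) * h19

theorem stmt17 :
    Irreducible (polyIter ((X : (ZMod 19)[X]) ^ 3 + X + C 1) 1) ∧
    Irreducible (polyIter ((X : (ZMod 19)[X]) ^ 3 + X + C 1) 2) ∧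
    ¬ Irreducible (polyIter ((X : (ZMod 19)[X]) ^ 3 + X + C 1) 3) := by
  refine ⟨?_, ?_, fun h ↦ ?_⟩
  · simpa only [polyIter, comp_X] using irreducible_X_pow_three_add_X_add_one
  · simpa only [polyIter, comp_X] using irreducible_X_pow_three_add_X_add_one_comp_self
  · rcases h.isUnit_or_isUnit polyIter_three_eq_mul with hu | hu <;>
      have hd := natDegree_eq_zero_of_isUnit hu
    · have : (X ^ 9 + 3 * X ^ 8 + 2 * X ^ 7 - X ^ 6 - 3 * X ^ 5 - 6 * X ^ 4 - X ^ 3 - X ^ 2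
          - 7 * X + 2 : (ZMod 19)[X]).natDegree = 9 := by compute_degree!
      omega
    · have : (X ^ 18 - 3 * X ^ 17 - 3 * X ^ 16 + 6 * X ^ 15 + 5 * X ^ 14 + X ^ 13 - 5 * X ^ 12
          + 2 * X ^ 11 + 8 * X ^ 9 - 2 * X ^ 8 + 6 * X ^ 7 - 7 * X ^ 6 + 2 * X ^ 5 + 2 * X ^ 4
          - 6 * X ^ 3 - 3 * X ^ 2 + X + 6 : (ZMod 19)[X]).natDegree = 18 := by compute_degree!
      omega
end

section
/- There are no dynamically irreducible cubics of the form x³ + b₁x + b₀ over F_5: for all b₀, b₁ ∈ F_5, there exists a positive integer n such that the n-fold composition of h(x) = x³ + b₁x + b₀ with itself is not irreducible over F_5. -/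
open Polynomial

instance : Fact (Nat.Prime 5) := ⟨by norm_num⟩

/-- The polynomial over `ZMod 5` with the given list of coefficients, constant term first. -/
noncomputable def listPoly : List ℕ → (ZMod 5)[X]
  | [] => 0
  | a :: l => C (a : ZMod 5) + X * listPoly l

/-- Coefficientwise sum of lists, padding the shorter one with zeros. -/
def listAdd : List ℕ → List ℕ → List ℕ
  | [], m => m
  | a :: l, [] => a :: l
  | a :: l, b :: m => (a + b) :: listAdd l m

/-- Product of coefficient lists. -/
def listMul : List ℕ → List ℕ → List ℕ
  | [], _ => []
  | a :: l, m => listAdd (m.map (a * ·)) (0 :: listMul l m)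

/-- Reduction of all coefficients modulo `5`. -/
def listMod (l : List ℕ) : List ℕ := l.map (· % 5)

/-- The coefficient list of `g ^ 3 + b₁ * g + b₀`. -/
def listStep (b₀ b₁ : ℕ) (g : List ℕ) : List ℕ :=
  listMod (listAdd (listMul g (listMod (listMul g g))) (listAdd (g.map (b₁ * ·)) [b₀]))

/-- The coefficient list of the `n`-th iterate of `X ^ 3 + b₁ * X + b₀`. -/
def listIter (b₀ b₁ : ℕ) : ℕ → List ℕ
  | 0 => [0, 1]
  | n + 1 => listStep b₀ b₁ (listIter b₀ b₁ n)

theorem listPoly_add (l m : List ℕ) : listPoly (listAdd l m) = listPoly l + listPoly m := by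
  induction l generalizing m with
  | nil => simp [listAdd, listPoly]
  | cons a l ih =>
    cases m with
    | nil => simp [listAdd, listPoly]
    | cons b m => simp only [listAdd, listPoly, ih, Nat.cast_add, C_add]; ring

theorem listPoly_map_mul (a : ℕ) (l : List ℕ) :
    listPoly (l.map (a * ·)) = C (a : ZMod 5) * listPoly l := by
  induction l with
  | nil => simp [listPoly]
  | cons b l ih => simp only [List.map_cons, listPoly, ih, Nat.cast_mul, C_mul]; ring

theorem listPoly_mul (l m : List ℕ) : listPoly (listMul l m) = listPoly l * listPoly m := by
  induction l with
  | nil => simp [listMul, listPoly]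
  | cons a l ih =>
    simp only [listMul, listPoly, listPoly_add, listPoly_map_mul, ih, Nat.cast_zero, C_0]; ring

theorem listPoly_mod (l : List ℕ) : listPoly (listMod l) = listPoly l := by
  induction l with
  | nil => rfl
  | cons a l ih =>
    have h : listMod (a :: l) = (a % 5) :: listMod l := rfl
    rw [h, listPoly, listPoly, ih, ZMod.natCast_mod]

theorem listPoly_iter (b₀ b₁ n : ℕ) :
    listPoly (listIter b₀ b₁ n) =
      polyIter ((X : (ZMod 5)[X]) ^ 3 + C (b₁ : ZMod 5) * X + C (b₀ : ZMod 5)) n := by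
  induction n with
  | zero => simp [listIter, listPoly, polyIter]
  | succ n ih =>
    simp only [listIter, listStep, listPoly_mod, listPoly_add, listPoly_mul, listPoly_map_mul, ih,
      polyIter, add_comp, mul_comp, pow_comp, X_comp, C_comp, listPoly]
    ring

theorem coeff_listPoly (l : List ℕ) (i : ℕ) :
    (listPoly l).coeff i = ((l.getD i 0 : ℕ) : ZMod 5) := by
  induction l generalizing i with
  | nil => simp [listPoly]
  | cons a l ih => cases i <;> simp [listPoly, ih]

theorem not_isUnit_listPoly {l : List ℕ} {i : ℕ} (hi : i ≠ 0) (h : l.getD i 0 = 1) :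
    ¬ IsUnit (listPoly l) := by
  intro hu
  have h0 : (listPoly l).coeff i = 0 :=
    coeff_eq_zero_of_natDegree_lt (by rw [natDegree_eq_zero_of_isUnit hu]; omega)
  rw [coeff_listPoly, h] at h0
  simp at h0

theorem exists_factorization_of_lists {b₀ b₁ : ℕ} (n : ℕ) (hn : 0 < n) (l m : List ℕ) (i j : ℕ)
    (hi : i ≠ 0) (hj : j ≠ 0) (hl : l.getD i 0 = 1) (hm : m.getD j 0 = 1)
    (h : listIter b₀ b₁ n = listMod (listMul l m)) :
    ∃ n : ℕ, 0 < n ∧ ∃ p q : (ZMod 5)[X], ¬ IsUnit p ∧ ¬ IsUnit q ∧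
      polyIter ((X : (ZMod 5)[X]) ^ 3 + C (b₁ : ZMod 5) * X + C (b₀ : ZMod 5)) n = p * q :=
  ⟨n, hn, listPoly l, listPoly m, not_isUnit_listPoly hi hl, not_isUnit_listPoly hj hm, by
    rw [← listPoly_iter, h, listPoly_mod, listPoly_mul]⟩

theorem polyIter_neg (b₀ b₁ : ZMod 5) (n : ℕ) :
    polyIter ((X : (ZMod 5)[X]) ^ 3 + C b₁ * X + C (-b₀)) n =
      -(polyIter ((X : (ZMod 5)[X]) ^ 3 + C b₁ * X + C b₀) n).comp (-X) := by
  induction n with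
  | zero => simp [polyIter]
  | succ n ih =>
    rw [polyIter, polyIter, ih]
    simp only [add_comp, mul_comp, pow_comp, X_comp, C_comp, C_neg, neg_comp]
    ring

theorem not_isUnit_comp_neg_X {p : (ZMod 5)[X]} (hp : ¬ IsUnit p) : ¬ IsUnit (p.comp (-X)) := by
  intro h
  apply hp
  have h' := h.map (compRingHom (-X : (ZMod 5)[X]))
  simpa [comp_assoc] using h'

theorem exists_not_irreducible_of_root {b₀ b₁ r : ZMod 5} (h : r ^ 3 + b₁ * r + b₀ = 0) :
    ∃ n : ℕ, 0 < n ∧ ¬ Irreducible (polyIter ((X : (ZMod 5)[X]) ^ 3 + C b₁ * X + C b₀) n) := by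
  refine ⟨1, one_pos, fun hirr => ?_⟩
  simp only [polyIter, comp_X] at hirr
  have h1 := degree_eq_one_of_irreducible_of_root hirr (x := r) (by simpa [IsRoot] using h)
  have h3 : ((X : (ZMod 5)[X]) ^ 3 + C b₁ * X + C b₀).degree = 3 := by compute_degree!
  rw [h3] at h1
  exact absurd h1 (by decide)

theorem exists_not_irreducible_of_factorization {b₀ b₁ : ZMod 5}
    (h : ∃ n : ℕ, 0 < n ∧ ∃ p q : (ZMod 5)[X], ¬ IsUnit p ∧ ¬ IsUnit q ∧
      polyIter ((X : (ZMod 5)[X]) ^ 3 + C b₁ * X + C b₀) n = p * q)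
    {c : ZMod 5} (hc : c = b₀ ∨ c = -b₀) :
    ∃ n : ℕ, 0 < n ∧ ¬ Irreducible (polyIter ((X : (ZMod 5)[X]) ^ 3 + C b₁ * X + C c) n) := by
  obtain ⟨n, hn, p, q, hp, hq, hpq⟩ := h
  refine ⟨n, hn, fun hirr => ?_⟩
  obtain rfl | rfl := hc
  · exact (hirr.isUnit_or_isUnit hpq).elim hp hq
  · rw [polyIter_neg, hpq, mul_comp, ← neg_mul] at hirr
    refine (hirr.isUnit_or_isUnit rfl).elim (fun hu => ?_) (not_isUnit_comp_neg_X hq)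
    exact not_isUnit_comp_neg_X hp ((IsUnit.neg_iff _).mp hu)

theorem exists_factorization_1_1 :
    ∃ n : ℕ, 0 < n ∧ ∃ p q : (ZMod 5)[X], ¬ IsUnit p ∧ ¬ IsUnit q ∧
      polyIter ((X : (ZMod 5)[X]) ^ 3 + C ((1 : ℕ) : ZMod 5) * X + C ((1 : ℕ) : ZMod 5)) n
        = p * q :=
  exists_factorization_of_lists 3 (by norm_num)
      [2, 3, 3, 3, 4, 0, 2, 3, 1, 1]
      [3, 4, 1, 3, 1, 4, 0, 2, 0, 2, 1, 3, 0, 1, 4, 3, 2, 4, 1]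
    9 18 (by norm_num) (by norm_num) (by decide +kernel) (by decide +kernel)
    (by decide +kernel)

theorem exists_factorization_2_1 :
    ∃ n : ℕ, 0 < n ∧ ∃ p q : (ZMod 5)[X], ¬ IsUnit p ∧ ¬ IsUnit q ∧
      polyIter ((X : (ZMod 5)[X]) ^ 3 + C ((2 : ℕ) : ZMod 5) * X + C ((1 : ℕ) : ZMod 5)) n
        = p * q :=
  exists_factorization_of_lists 4 (by norm_num)
      [3, 3, 4, 3, 3, 0, 3, 1, 3, 4, 3, 0, 0, 4, 1, 0, 3, 3, 0, 3, 0, 1, 1, 4, 1, 3, 2, 1]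
      [3, 2, 4, 2, 0, 0, 2, 1, 1, 4, 2, 3, 4, 2, 2, 4, 0, 3, 0, 3, 4, 2, 1, 4, 2, 2, 3, 2, 2, 3,
      4, 3, 0, 4, 0, 2, 3, 0, 3, 4, 4, 1, 0, 1, 2, 3, 2, 2, 1, 4, 3, 2, 0, 3, 1]
    27 54 (by norm_num) (by norm_num) (by decide +kernel) (by decide +kernel)
    (by decide +kernel)

theorem exists_factorization_3_2 :
    ∃ n : ℕ, 0 < n ∧ ∃ p q : (ZMod 5)[X], ¬ IsUnit p ∧ ¬ IsUnit q ∧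
      polyIter ((X : (ZMod 5)[X]) ^ 3 + C ((3 : ℕ) : ZMod 5) * X + C ((2 : ℕ) : ZMod 5)) n
        = p * q :=
  exists_factorization_of_lists 4 (by norm_num)
      [4, 1, 4, 3, 0, 2, 0, 2, 2, 1, 2, 0, 3, 3, 3, 2, 2, 1, 4, 4, 1, 2, 4, 0, 2, 2, 1, 1]
      [4, 4, 1, 2, 1, 2, 2, 4, 4, 2, 3, 4, 2, 0, 1, 4, 2, 4, 2, 2, 2, 0, 1, 2, 4, 1, 3, 3, 1, 0,
      4, 2, 1, 3, 1, 3, 4, 3, 0, 3, 0, 1, 0, 3, 1, 4, 1, 3, 3, 3, 2, 4, 0, 4, 1]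
    27 54 (by norm_num) (by norm_num) (by decide +kernel) (by decide +kernel)
    (by decide +kernel)

theorem exists_factorization_4_2 :
    ∃ n : ℕ, 0 < n ∧ ∃ p q : (ZMod 5)[X], ¬ IsUnit p ∧ ¬ IsUnit q ∧
      polyIter ((X : (ZMod 5)[X]) ^ 3 + C ((4 : ℕ) : ZMod 5) * X + C ((2 : ℕ) : ZMod 5)) n
        = p * q :=
  exists_factorization_of_lists 5 (by norm_num)
      [3, 4, 2, 2, 3, 0, 2, 2, 0, 0, 1, 3, 1, 3, 4, 0, 2, 1, 2, 3, 0, 2, 3, 1, 1, 1, 2, 4, 0, 2,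
      4, 3, 0, 2, 0, 3, 1, 2, 3, 3, 1, 1, 4, 2, 1, 2, 2, 2, 2, 2, 4, 1, 0, 2, 4, 2, 3, 1, 1, 1,
      2, 3, 3, 3, 2, 4, 4, 0, 3, 1, 3, 1, 1, 0, 1, 2, 3, 0, 4, 1, 3, 1]
      [1, 3, 1, 3, 4, 0, 3, 3, 0, 3, 2, 0, 0, 0, 4, 4, 4, 3, 4, 0, 3, 4, 1, 0, 2, 3, 3, 0, 2, 1,
      4, 0, 1, 4, 0, 1, 2, 2, 0, 4, 3, 3, 1, 1, 2, 0, 1, 0, 1, 2, 1, 0, 1, 1, 4, 3, 3, 1, 3, 4,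
      1, 4, 4, 1, 3, 1, 2, 2, 3, 4, 3, 1, 4, 0, 2, 3, 3, 3, 2, 4, 2, 4, 2, 0, 3, 0, 3, 0, 1, 1,
      1, 0, 0, 4, 0, 2, 2, 1, 0, 3, 3, 0, 0, 2, 1, 1, 3, 0, 4, 4, 2, 3, 4, 4, 2, 3, 2, 2, 1, 2,
      0, 0, 0, 3, 1, 0, 0, 1, 4, 1, 3, 0, 1, 0, 4, 2, 3, 4, 2, 2, 0, 2, 3, 3, 4, 4, 3, 1, 3, 3,
      2, 4, 2, 2, 0, 1, 3, 4, 0, 0, 2, 2, 1]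
    81 162 (by norm_num) (by norm_num) (by decide +kernel) (by decide +kernel)
    (by decide +kernel)

theorem stmt18 :
    ∀ b₀ b₁ : ZMod 5, ∃ n : ℕ, 0 < n ∧
      ¬ Irreducible (polyIter ((X : (ZMod 5)[X]) ^ 3 + C b₁ * X + C b₀) n) := by
  intro b₀ b₁
  have key : ∀ c₀ c₁ : ZMod 5, (∃ r : ZMod 5, r ^ 3 + c₁ * r + c₀ = 0) ∨
      (((1 : ℕ) : ZMod 5) = c₁ ∧ (c₀ = (1 : ℕ) ∨ c₀ = -(1 : ℕ))) ∨
      (((2 : ℕ) : ZMod 5) = c₁ ∧ (c₀ = (1 : ℕ) ∨ c₀ = -(1 : ℕ))) ∨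
      (((3 : ℕ) : ZMod 5) = c₁ ∧ (c₀ = (2 : ℕ) ∨ c₀ = -(2 : ℕ))) ∨
      (((4 : ℕ) : ZMod 5) = c₁ ∧ (c₀ = (2 : ℕ) ∨ c₀ = -(2 : ℕ))) := by
    decide
  obtain ⟨r, hr⟩ | ⟨rfl, hc⟩ | ⟨rfl, hc⟩ | ⟨rfl, hc⟩ | ⟨rfl, hc⟩ := key b₀ b₁
  · exact exists_not_irreducible_of_root hr
  · exact exists_not_irreducible_of_factorization exists_factorization_1_1 hc
  · exact exists_not_irreducible_of_factorization exists_factorization_2_1 hc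
  · exact exists_not_irreducible_of_factorization exists_factorization_3_2 hc
  · exact exists_not_irreducible_of_factorization exists_factorization_4_2 hc
end

section
/- There are no dynamically irreducible cubic polynomials over F_3: for every polynomial f ∈ F_3[x] of degree 3, there exists a positive integer n such that the n-fold composition f^n is not irreducible over F_3. -/
open Polynomial

instance : Fact (Nat.Prime 3) := ⟨by norm_num⟩

namespace CoeffList

variable {R : Type*} [CommRing R]

/-- The polynomial whose coefficients, in increasing degree, are the entries of a list. -/
noncomputable def toPoly : List R → R[X]
  | [] => 0
  | a :: p => C a + X * toPoly p

/-- Addition of coefficient lists. -/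
def add : List R → List R → List R
  | [], q => q
  | p, [] => p
  | a :: p, b :: q => (a + b) :: add p q

/-- Multiplication of coefficient lists. -/
def mul : List R → List R → List R
  | [], _ => []
  | a :: p, q => add (q.map (a * ·)) (0 :: mul p q)

/-- Composition of coefficient lists. -/
def comp : List R → List R → List R
  | [], _ => []
  | a :: p, q => add [a] (mul q (comp p q))

/-- Iterated composition of a coefficient list. -/
def iter (p : List R) : ℕ → List R
  | 0 => [0, 1]
  | n + 1 => comp p (iter p n)

theorem toPoly_add (p q : List R) : toPoly (add p q) = toPoly p + toPoly q := by
  induction p generalizing q with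
  | nil => simp [add, toPoly]
  | cons a p ih =>
    cases q with
    | nil => simp [add, toPoly]
    | cons b q => simp only [add, toPoly, ih, C_add]; ring

theorem toPoly_map_mul (a : R) (p : List R) : toPoly (p.map (a * ·)) = C a * toPoly p := by
  induction p with
  | nil => simp [toPoly]
  | cons b p ih => simp only [List.map_cons, toPoly, ih, C_mul]; ring

theorem toPoly_mul (p q : List R) : toPoly (mul p q) = toPoly p * toPoly q := by
  induction p with
  | nil => simp [mul, toPoly]
  | cons a p ih => simp only [mul, toPoly, toPoly_add, toPoly_map_mul, ih, C_0]; ring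

theorem toPoly_comp (p q : List R) : toPoly (comp p q) = (toPoly p).comp (toPoly q) := by
  induction p with
  | nil => simp [comp, toPoly]
  | cons a p ih => simp [comp, toPoly, toPoly_add, toPoly_mul, ih]

theorem toPoly_iter {K : Type*} [Field K] (p : List K) (n : ℕ) :
    toPoly (iter p n) = polyIter (toPoly p) n := by
  induction n with
  | zero => simp [iter, toPoly, polyIter]
  | succ n ih => rw [iter, toPoly_comp, ih, polyIter]

theorem toPoly_eq_zero {p : List R} (h : ∀ a ∈ p, a = 0) : toPoly p = 0 := by
  induction p with
  | nil => rfl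
  | cons a p ih =>
    rw [List.forall_mem_cons] at h
    simp [toPoly, h.1, ih h.2]

theorem toPoly_eq_of_sub {p q : List R} (h : ∀ a ∈ add p (q.map (-1 * ·)), a = 0) :
    toPoly p = toPoly q := by
  have h' := toPoly_eq_zero h
  rw [toPoly_add, toPoly_map_mul] at h'
  simpa [← sub_eq_add_neg, sub_eq_zero] using h'

theorem degree_toPoly_lt (p : List R) : (toPoly p).degree < p.length := by
  rw [degree_lt_iff_coeff_zero]
  induction p with
  | nil => simp [toPoly]
  | cons a p ih =>
    intro m hm
    obtain ⟨k, rfl⟩ : ∃ k, m = k + 1 := ⟨m - 1, by simp at hm; omega⟩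
    simp only [List.length_cons, add_le_add_iff_right] at hm
    simp [toPoly, coeff_X_mul, ih k hm]

/-- Cubics without roots over `ZMod 3`, each given as `(f, n, g, h)` where the `n`-th iterate
of `f` is the product of `g` and `h`. -/
def factorizations : List (List (ZMod 3) × ℕ × List (ZMod 3) × List (ZMod 3)) :=
  [
    ([1, 0, 2, 1], 2,
      [2, 0, 1, 1],
      [2, 0, 0, 1, 1, 2, 1]),
    ([1, 0, 2, 2], 4,
      [1, 0, 2, 1, 2, 0, 2, 2, 1, 0, 1, 1, 2, 0, 0, 0, 2, 1, 1, 1, 0, 1, 0, 1, 2, 0, 1, 1],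
      [2, 0, 0, 2, 1, 0, 0, 0, 1, 1, 2, 2, 0, 2, 2, 1, 0, 0, 2, 1, 0, 2, 1, 1, 0, 0, 1, 0, 2, 2,
       0, 1, 2, 1, 0, 1, 0, 2, 2, 0, 0, 2, 1, 0, 0, 0, 2, 2, 0, 1, 1, 0, 1, 2, 1]),
    ([1, 1, 0, 2], 2,
      [2, 1, 1, 1],
      [2, 1, 0, 2, 0, 2, 1]),
    ([1, 1, 1, 2], 2,
      [2, 0, 1, 1],
      [1, 0, 0, 0, 1, 2, 1]),
    ([1, 1, 2, 1], 2,
      [2, 2, 0, 1],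
      [1, 0, 0, 2, 1, 0, 1]),
    ([1, 2, 0, 1], 2,
      [2, 1, 1, 1],
      [2, 1, 0, 2, 0, 2, 1]),
    ([1, 2, 1, 1], 3,
      [2, 2, 2, 0, 2, 1, 1, 2, 1, 1],
      [1, 2, 2, 1, 0, 1, 2, 0, 2, 1, 1, 1, 2, 2, 0, 2, 2, 2, 1]),
    ([1, 2, 2, 2], 2,
      [1, 2, 1, 1],
      [1, 1, 2, 2, 2, 2, 1]),
    ([2, 0, 1, 1], 2,
      [1, 2, 1, 1],
      [2, 2, 1, 1, 2, 2, 1]),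
    ([2, 0, 1, 2], 4,
      [2, 0, 1, 1, 1, 2, 2, 0, 1, 1, 1, 1, 2, 2, 2, 1, 1, 1, 0, 2, 1, 1, 0, 0, 2, 0, 2, 1],
      [2, 0, 0, 1, 1, 1, 2, 0, 1, 1, 0, 0, 0, 1, 2, 2, 2, 1, 2, 2, 1, 2, 0, 1, 0, 2, 0, 2, 2, 0,
       2, 0, 1, 0, 0, 2, 1, 1, 0, 1, 1, 0, 0, 0, 1, 0, 0, 0, 2, 1, 0, 2, 1, 1, 1]),
    ([2, 1, 0, 2], 2,
      [1, 1, 2, 1],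
      [2, 2, 0, 1, 0, 1, 1]),
    ([2, 1, 1, 1], 2,
      [1, 2, 0, 1],
      [1, 0, 0, 1, 1, 0, 1]),
    ([2, 1, 2, 2], 2,
      [1, 0, 2, 1],
      [1, 0, 0, 0, 1, 1, 1]),
    ([2, 2, 0, 1], 2,
      [1, 0, 2, 1],
      [2, 1, 2, 0, 1, 1, 1]),
    ([2, 2, 1, 2], 2,
      [2, 2, 2, 1],
      [1, 2, 2, 1, 2, 1, 1]),
    ([2, 2, 2, 1], 3,
      [2, 2, 2, 2, 0, 2, 2, 2, 1, 1],
      [2, 1, 1, 1, 2, 0, 1, 0, 2, 1, 0, 2, 1, 1, 1, 1, 2, 2, 1])]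

theorem factorizations_valid : ∀ t ∈ factorizations, 0 < t.2.1 ∧
    t.2.2.1.length ≤ 3 ^ t.2.1 ∧ t.2.2.2.length ≤ 3 ^ t.2.1 ∧
    ∀ a ∈ add (iter t.1 t.2.1) ((mul t.2.2.1 t.2.2.2).map (-1 * ·)), a = 0 := by
  decide +kernel

theorem exists_root_or_mem_factorizations : ∀ a b c d : ZMod 3, d ≠ 0 →
    (∃ x, a + b * x + c * x ^ 2 + d * x ^ 3 = 0) ∨
      ∃ t ∈ factorizations, t.1 = [a, b, c, d] := by
  decide +kernel

end CoeffList

theorem Polynomial.not_irreducible_mul_of_degree_lt {K : Type*} [Field K] {g h : K[X]}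
    (hg : g.degree < (g * h).degree) (hh : h.degree < (g * h).degree) :
    ¬ Irreducible (g * h) := by
  intro hirr
  rcases hirr.isUnit_or_isUnit rfl with hu | hu
  · simp [degree_mul, degree_eq_zero_of_isUnit hu] at hh
  · simp [degree_mul, degree_eq_zero_of_isUnit hu] at hg

open CoeffList in
theorem stmt19 :
    ∀ f : (ZMod 3)[X], f.natDegree = 3 →
      ∃ n : ℕ, 0 < n ∧ ¬ Irreducible (polyIter f n) := by
  intro f hf
  have hsum := f.as_sum_range_C_mul_X_pow
  simp only [hf, Finset.sum_range_succ, Finset.sum_range_zero, zero_add, pow_zero, mul_one,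
    pow_one] at hsum
  have hlead : f.coeff 3 ≠ 0 := by
    have hf0 : f ≠ 0 := fun h => by simp [h] at hf
    simpa only [leadingCoeff, hf] using leadingCoeff_ne_zero.mpr hf0
  rcases exists_root_or_mem_factorizations (f.coeff 0) (f.coeff 1) (f.coeff 2) (f.coeff 3) hlead
    with ⟨x, hx⟩ | ⟨⟨p, n, g, h⟩, hmem, hp⟩
  · refine ⟨1, one_pos, fun hirr => ?_⟩
    simp only [polyIter, comp_X] at hirr
    have hroot : f.IsRoot x := by
      rw [IsRoot.def, hsum]
      simpa using hx
    have hdeg : f.natDegree = 1 :=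
      natDegree_eq_of_degree_eq_some (degree_eq_one_of_irreducible_of_root hirr hroot)
    simp [hf] at hdeg
  · obtain ⟨hn, hg, hh, hfac⟩ := factorizations_valid _ hmem
    dsimp only at hp hn hg hh hfac
    have hfp : toPoly p = f := by
      rw [hsum, hp]
      simp only [toPoly]
      ring
    have hprod : polyIter f n = toPoly g * toPoly h := by
      rw [← hfp, ← toPoly_iter, ← toPoly_mul]
      exact toPoly_eq_of_sub hfac
    have hdeg : (toPoly g * toPoly h).degree = (3 ^ n : ℕ) := by
      rw [← hprod, degree_eq_iff_natDegree_eq_of_pos (by positivity), natDegree_polyIter, hf]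
    refine ⟨n, hn, hprod ▸ not_irreducible_mul_of_degree_lt ?_ ?_⟩
    · exact hdeg ▸ (degree_toPoly_lt g).trans_le (by exact_mod_cast hg)
    · exact hdeg ▸ (degree_toPoly_lt h).trans_le (by exact_mod_cast hh)
end
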